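/- Let χ be a character of T of minimal depth r and let d ≥ r+1. Then the complex dimension of the space of ℂ-linear endomorphisms of V_χ^{K_d} commuting with the right-translation action of K equals d+1 if r = 0 and χ is trivial on O_F^×, and equals d − r otherwise. -/

import Mathlib

open Matrix

noncomputable section

/-- A 2×2 matrix over `E`. -/
abbrev Mat (E : Type) := Matrix (Fin 2) (Fin 2) E

/-- The context: `E/F` is the unramified quadratic extension of a finite extension `F` of
`ℚ_p` (`p` odd), encoded via the Galois involution `sig` (whose fixed field is `F`),
the valuation `nu` (normalized by `nu ϖ = 1` for a uniformizer `ϖ` of `F`),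
a square root `sqeps` of a non-square unit `eps = sqeps^2` of `O_F`, the residue-field
cardinality `q` of `F`, and an additive character `psi'` of `F` trivial on `p_F` and
nontrivial on `O_F`. -/
structure USetting (E : Type) [Field E] where
  sig : E →+* E
  nu : E → WithTop ℤ
  sqeps : E
  pi : E
  q : ℕ
  psi' : E → ℂ
  sig_invol : ∀ x, sig (sig x) = x
  sig_ne : ∃ x, sig x ≠ x
  nu_eq_top : ∀ x, nu x = ⊤ ↔ x = 0
  nu_mul : ∀ x y, nu (x * y) = nu x + nu y
  nu_add : ∀ x y, min (nu x) (nu y) ≤ nu (x + y)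
  nu_sig : ∀ x, nu (sig x) = nu x
  nu_pi : nu pi = 1
  sig_pi : sig pi = pi
  sig_sqeps : sig sqeps = - sqeps
  nu_sqeps : nu sqeps = 0
  eps_not_square : ∀ y, sig y = y → y * y ≠ sqeps * sqeps
  gen : ∀ x : E, ∃ a b, sig a = a ∧ sig b = b ∧ x = a + b * sqeps
  nu_two : nu 2 = 0
  charzero : ∀ n : ℕ, (n : E) = 0 → n = 0
  complete : ∀ f : ℕ → E, (∀ n : ℕ, ((n : ℤ) : WithTop ℤ) ≤ nu (f (n + 1) - f n)) →
    ∃ L, ∀ n : ℕ, ((n : ℤ) : WithTop ℤ) ≤ nu (L - f n)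
  res_card : ∃ R : Finset E, R.card = q ∧ (∀ x ∈ R, sig x = x ∧ 0 ≤ nu x) ∧
    ∀ y : E, sig y = y → 0 ≤ nu y → ∃! x, x ∈ R ∧ 1 ≤ nu (y - x)
  psi'_mul : ∀ x y, sig x = x → sig y = y → psi' (x + y) = psi' x * psi' y
  psi'_ne : ∀ x, sig x = x → psi' x ≠ 0
  psi'_triv : ∀ x, sig x = x → 1 ≤ nu x → psi' x = 1
  psi'_nontriv : ∃ x, sig x = x ∧ 0 ≤ nu x ∧ psi' x ≠ 1

variable {E : Type} [Field E]

/-- The matrix `w₀ = [[0,1],[1,0]]`. -/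
def w0 (E : Type) [Field E] : Mat E := !![0, 1; 1, 0]

/-- `G = U(1,1)(F)`. -/
def Gset (S : USetting E) : Set (Mat E) :=
  {g | (g.map ⇑S.sig)ᵀ * w0 E * g = w0 E}

/-- `K = G ∩ GL₂(O_E)`: entries in `O_E` and determinant in `O_E^×`. -/
def Kset (S : USetting E) : Set (Mat E) :=
  {g | g ∈ Gset S ∧ (∀ i j, 0 ≤ S.nu (g i j)) ∧ S.nu g.det = 0}

/-- The congruence filtration subgroup `K_n` (for `n ≥ 1`; `K_0 = K` as a set). -/
def Kfil (S : USetting E) (n : ℤ) : Set (Mat E) :=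
  {g | g ∈ Kset S ∧ ∀ i j, (n : WithTop ℤ) ≤ S.nu ((g - 1) i j)}

/-- `𝓑 = B ∩ K`, the upper triangular matrices in `K`. -/
def Bcal (S : USetting E) : Set (Mat E) := {g | g ∈ Kset S ∧ g 1 0 = 0}

/-- `E^1`, the norm-one elements of `E`. -/
def E1set (S : USetting E) : Set E := {x | x * S.sig x = 1}

/-- `O_F^×` as a subset of `E`. -/
def OFunits (S : USetting E) : Set E := {x | S.sig x = x ∧ S.nu x = 0}

/-- `O_E^×` as a subset of `E`. -/
def OEunits (S : USetting E) : Set E := {x | S.nu x = 0}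

/-- A character of `E^×`, encoded as a function `E → ℂ` multiplicative and
nonvanishing on nonzero elements. -/
def IsChar (χ : E → ℂ) : Prop :=
  (∀ x y : E, x ≠ 0 → y ≠ 0 → χ (x * y) = χ x * χ y) ∧ ∀ x : E, x ≠ 0 → χ x ≠ 0

/-- A group homomorphism `E^1 → ℂ^×`, encoded as a function `E → ℂ`. -/
def IsE1Hom (S : USetting E) (φ : E → ℂ) : Prop :=
  (∀ x ∈ E1set S, ∀ y ∈ E1set S, φ (x * y) = φ x * φ y) ∧ ∀ x ∈ E1set S, φ x ≠ 0

/-- A homomorphism into `ℂ^×` on a subset of matrices. -/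
def IsHomOn (A : Set (Mat E)) (Ψ : Mat E → ℂ) : Prop :=
  (∀ x ∈ A, ∀ y ∈ A, Ψ (x * y) = Ψ x * Ψ y) ∧ ∀ x ∈ A, Ψ x ≠ 0

/-- `1 + p_E^n`. -/
def onePE (S : USetting E) (n : ℤ) : Set E := {x | (n : WithTop ℤ) ≤ S.nu (x - 1)}

/-- `1 + p_F^n`. -/
def onePF (S : USetting E) (n : ℤ) : Set E :=
  {x | S.sig x = x ∧ (n : WithTop ℤ) ≤ S.nu (x - 1)}

/-- `χ` is trivial on a set. -/
def TrivOn (χ : E → ℂ) (s : Set E) : Prop := ∀ x ∈ s, χ x = 1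

/-- `χ` has depth `r`: trivial on `1+p_E^{r+1}` and (if `r ≥ 1`) nontrivial on `1+p_E^r`. -/
def HasDepth (S : USetting E) (χ : E → ℂ) (r : ℕ) : Prop :=
  TrivOn χ (onePE S ((r : ℤ) + 1)) ∧ (r = 0 ∨ ¬ TrivOn χ (onePE S (r : ℤ)))

/-- `χ` has true depth `r`: the depth of its restriction to `F^×` is `r`. -/
def HasTrueDepth (S : USetting E) (χ : E → ℂ) (r : ℕ) : Prop :=
  TrivOn χ (onePF S ((r : ℤ) + 1)) ∧ (r = 0 ∨ ¬ TrivOn χ (onePF S (r : ℤ)))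

/-- `χ` has minimal depth `r`: its depth and true depth both equal `r`. -/
def MinDepth (S : USetting E) (χ : E → ℂ) (r : ℕ) : Prop :=
  HasDepth S χ r ∧ HasTrueDepth S χ r

/-- Right translation action on functions. -/
def rho (g : Mat E) : (Mat E → ℂ) →ₗ[ℂ] (Mat E → ℂ) where
  toFun f := fun k => f (k * g)
  map_add' _ _ := rfl
  map_smul' _ _ := rfl

/-- The space `V_χ^{K_n}`: functions on `K` (extended by zero off `K`) satisfying
`f(bk) = χ(b₁₁) f(k)` for `b ∈ 𝓑` and right `K_n`-invariance. -/
def Vsp (S : USetting E) (χ : E → ℂ) (n : ℤ) : Submodule ℂ (Mat E → ℂ) where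
  carrier := {f | (∀ x, x ∉ Kset S → f x = 0) ∧
    (∀ b ∈ Bcal S, ∀ k ∈ Kset S, f (b * k) = χ (b 0 0) * f k) ∧
    (∀ k ∈ Kset S, ∀ g ∈ Kfil S n, f (k * g) = f k)}
  add_mem' := by
    rintro f g ⟨hf0, hf1, hf2⟩ ⟨hg0, hg1, hg2⟩
    refine ⟨fun x hx => ?_, fun b hb k hk => ?_, fun k hk g' hg' => ?_⟩
    · simp [hf0 x hx, hg0 x hx]
    · simp only [Pi.add_apply, hf1 b hb k hk, hg1 b hb k hk]; ring
    · simp only [Pi.add_apply, hf2 k hk g' hg', hg2 k hk g' hg']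
  zero_mem' := by
    refine ⟨fun x _ => rfl, fun b _ k _ => by simp, fun k _ g _ => rfl⟩
  smul_mem' := by
    rintro c f ⟨hf0, hf1, hf2⟩
    refine ⟨fun x hx => ?_, fun b hb k hk => ?_, fun k hk g' hg' => ?_⟩
    · simp [hf0 x hx]
    · simp only [Pi.smul_apply, hf1 b hb k hk, smul_eq_mul]; ring
    · simp only [Pi.smul_apply, hf2 k hk g' hg']

/-- The space of the representation induced from a character `Ψ` of a subgroup `H ⊆ K`:
functions on `K` (extended by zero) with `f(hk) = Ψ(h) f(k)`. -/
def IndSp (S : USetting E) (H : Set (Mat E)) (Ψ : Mat E → ℂ) : Submodule ℂ (Mat E → ℂ) where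
  carrier := {f | (∀ x, x ∉ Kset S → f x = 0) ∧
    ∀ h ∈ H, ∀ k ∈ Kset S, f (h * k) = Ψ h * f k}
  add_mem' := by
    rintro f g ⟨hf0, hf1⟩ ⟨hg0, hg1⟩
    refine ⟨fun x hx => ?_, fun h hh k hk => ?_⟩
    · simp [hf0 x hx, hg0 x hx]
    · simp only [Pi.add_apply, hf1 h hh k hk, hg1 h hh k hk]; ring
  zero_mem' := ⟨fun x _ => rfl, fun h _ k _ => by simp⟩
  smul_mem' := by
    rintro c f ⟨hf0, hf1⟩
    refine ⟨fun x hx => ?_, fun h hh k hk => ?_⟩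
    · simp [hf0 x hx]
    · simp only [Pi.smul_apply, hf1 h hh k hk, smul_eq_mul]; ring

/-- The functions constant on `K` and zero off `K`. -/
def ConstSub (S : USetting E) : Submodule ℂ (Mat E → ℂ) where
  carrier := {f | (∀ x, x ∉ Kset S → f x = 0) ∧ ∃ c : ℂ, ∀ k ∈ Kset S, f k = c}
  add_mem' := by
    rintro f g ⟨hf0, c, hc⟩ ⟨hg0, c', hc'⟩
    exact ⟨fun x hx => by simp [hf0 x hx, hg0 x hx],
      c + c', fun k hk => by simp [hc k hk, hc' k hk]⟩
  zero_mem' := ⟨fun x _ => rfl, 0, fun _ _ => rfl⟩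
  smul_mem' := by
    rintro a f ⟨hf0, c, hc⟩
    exact ⟨fun x hx => by simp [hf0 x hx], a * c, fun k hk => by simp [hc k hk]⟩

/-- A subspace is `K`-invariant. -/
def KInvariant (S : USetting E) (W : Submodule ℂ (Mat E → ℂ)) : Prop :=
  ∀ g ∈ Kset S, ∀ f ∈ W, rho g f ∈ W

/-- A subset `A ⊆ K` acts trivially on `W`. -/
def ActsTrivially (S : USetting E) (A : Set (Mat E)) (W : Submodule ℂ (Mat E → ℂ)) : Prop :=
  ∀ g ∈ A, ∀ f ∈ W, rho g f = f

/-- `W` is an irreducible representation of `K`. -/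
def IsIrredRep (S : USetting E) (W : Submodule ℂ (Mat E → ℂ)) : Prop :=
  W ≠ ⊥ ∧ KInvariant S W ∧
    ∀ U : Submodule ℂ (Mat E → ℂ), U ≤ W → KInvariant S U → U = ⊥ ∨ U = W

/-- `V` and `W` are isomorphic as representations of `K`. -/
def RepIso (S : USetting E) (V W : Submodule ℂ (Mat E → ℂ)) : Prop :=
  ∃ e : (Mat E → ℂ) →ₗ[ℂ] (Mat E → ℂ), Set.BijOn ⇑e ↑V ↑W ∧
    ∀ g ∈ Kset S, ∀ f ∈ V, e (rho g f) = rho g (e f)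

/-- The space of `ℂ`-linear endomorphisms of `V` commuting with the right-translation
action of `K`, realized inside the function space `↥V → ↥V`. -/
def Commutant (S : USetting E) (V : Submodule ℂ (Mat E → ℂ)) :
    Submodule ℂ (↥V → ↥V) where
  carrier := {T | (∀ x y : ↥V, T (x + y) = T x + T y) ∧
    (∀ (c : ℂ) (x : ↥V), T (c • x) = c • T x) ∧
    ∀ g ∈ Kset S, ∀ f : ↥V, ∀ h : rho g (f : Mat E → ℂ) ∈ V,
      ((T ⟨rho g (f : Mat E → ℂ), h⟩ : ↥V) : Mat E → ℂ) = rho g ((T f : ↥V) : Mat E → ℂ)}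
  add_mem' := by
    rintro T T' ⟨hT1, hT2, hT3⟩ ⟨hT1', hT2', hT3'⟩
    refine ⟨fun x y => ?_, fun c x => ?_, fun g hg f h => ?_⟩
    · simp only [Pi.add_apply, hT1 x y, hT1' x y]; abel
    · simp only [Pi.add_apply, hT2 c x, hT2' c x, smul_add]
    · simp only [Pi.add_apply, Submodule.coe_add, hT3 g hg f h, hT3' g hg f h, map_add]
  zero_mem' := by
    refine ⟨fun x y => by simp, fun c x => by simp, fun g hg f h => by simp⟩
  smul_mem' := by
    rintro c T ⟨hT1, hT2, hT3⟩
    refine ⟨fun x y => ?_, fun a x => ?_, fun g hg f h => ?_⟩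
    · simp only [Pi.smul_apply, hT1 x y, smul_add]
    · simp only [Pi.smul_apply, hT2 a x, smul_comm c a]
    · simp only [Pi.smul_apply, Submodule.coe_smul, hT3 g hg f h, _root_.map_smul]

/-- The additive character `ψ` of `E`, `ψ(x) = ψ'((x + σ(x))/2)`. -/
def psiE (S : USetting E) (x : E) : ℂ := S.psi' ((x + S.sig x) / 2)

/-- `Ψ_Y(g) = ψ(Tr(Y (g − 1)))`. -/
def PsiC (S : USetting E) (Y g : Mat E) : ℂ := psiE S ((Y * (g - 1)).trace)

/-- The Lie algebra `𝔤 = 𝔲(1,1)(F)`. -/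
def gfrak (S : USetting E) : Set (Mat E) :=
  {Y | (Y.map ⇑S.sig)ᵀ * w0 E + w0 E * Y = 0}

/-- The lattice `𝔨_s` of the Lie algebra, where `c = ⌈s⌉`. -/
def kfrakC (S : USetting E) (c : ℤ) : Set (Mat E) :=
  {Y | Y ∈ gfrak S ∧ (c : WithTop ℤ) ≤ S.nu (Y 0 0) ∧ (c : WithTop ℤ) ≤ S.nu (Y 1 1) ∧
    (∃ t, S.sig t = t ∧ (c : WithTop ℤ) ≤ S.nu t ∧ Y 0 1 = S.sqeps * t) ∧
    (∃ t, S.sig t = t ∧ (c : WithTop ℤ) ≤ S.nu t ∧ Y 1 0 = S.sqeps * t)}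

/-- The group `J_d`. -/
def Jgrp (S : USetting E) (d : ℕ) : Set (Mat E) :=
  {g | g ∈ Kset S ∧ ((((d + 1) / 2 : ℕ) : WithTop ℤ) ≤ S.nu (g 0 0 - 1)) ∧
    ((((d + 1) / 2 : ℕ) : WithTop ℤ) ≤ S.nu (g 0 1)) ∧
    ((((d + 1) / 2 : ℕ) : WithTop ℤ) ≤ S.nu (g 1 1 - 1)) ∧
    (((d / 2 + 1 : ℕ) : WithTop ℤ) ≤ S.nu (g 1 0))}

/-- The centralizer `T(X)` in `K` of `X = [[z√ε, u√ε],[v√ε, z√ε]]`. -/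
def TXset (S : USetting E) (u v : E) : Set (Mat E) :=
  {m | m ∈ Kset S ∧ m 1 1 = m 0 0 ∧ m 1 0 = m 0 1 * (u⁻¹ * v)}

/-- The center `Z` of `G`, identified with scalar matrices with entries in `E^1`. -/
def Zset (S : USetting E) : Set (Mat E) := {m | ∃ z ∈ E1set S, m = z • (1 : Mat E)}

/-- `𝒰 = U ∩ K`. -/
def Uset (S : USetting E) : Set (Mat E) :=
  {m | ∃ b, S.sig b = b ∧ 0 ≤ S.nu b ∧ m = !![1, b * S.sqeps; 0, 1]}

/-- The set of products `T(X)·J_d`. -/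
def TXJ (S : USetting E) (u v : E) (d : ℕ) : Set (Mat E) :=
  {x | ∃ t ∈ TXset S u v, ∃ j ∈ Jgrp S d, x = t * j}

/-- The set of products `Z·𝒰·J_d`. -/
def ZUJ (S : USetting E) (d : ℕ) : Set (Mat E) :=
  {x | ∃ z ∈ Zset S, ∃ m ∈ Uset S, ∃ j ∈ Jgrp S d, x = z * m * j}

/-- `X = [[z√ε, u√ε],[v√ε, z√ε]]`. -/
def Xzuv (S : USetting E) (z u v : E) : Mat E :=
  !![z * S.sqeps, u * S.sqeps; v * S.sqeps, z * S.sqeps]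

/-- The nilpotent element `X_δ = [[0, δ√ε],[0,0]]`. -/
def Xdelta (S : USetting E) (δ : E) : Mat E := !![0, δ * S.sqeps; 0, 0]

/-- `W` is a `K`-invariant complement of `V_χ^{K_d}` inside `V_χ^{K_{d+1}}`. -/
def Wcompl (S : USetting E) (χ : E → ℂ) (d : ℕ) (W : Submodule ℂ (Mat E → ℂ)) : Prop :=
  W ≤ Vsp S χ ((d : ℤ) + 1) ∧ KInvariant S W ∧
    Vsp S χ (d : ℤ) ⊓ W = ⊥ ∧ Vsp S χ (d : ℤ) ⊔ W = Vsp S χ ((d : ℤ) + 1)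

namespace USetting

variable {S : USetting E}

theorem nu_one : S.nu 1 = 0 := by
  have h := S.nu_mul 1 1
  have h0 : S.nu (1 : E) ≠ ⊤ := fun h => one_ne_zero ((S.nu_eq_top 1).1 h)
  lift S.nu (1 : E) to ℤ using h0 with a ha
  rw [mul_one, ← ha] at h
  norm_cast at h ⊢
  omega

theorem nu_neg (x : E) : S.nu (-x) = S.nu x := by
  have h2 : S.nu (-1 : E) = 0 := by
    have h := S.nu_mul (-1) (-1)
    have h0 : S.nu (-1 : E) ≠ ⊤ := fun h => by simpa using (S.nu_eq_top (-1)).1 h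
    rw [neg_mul_neg, one_mul, nu_one] at h
    lift S.nu (-1 : E) to ℤ using h0 with a
    norm_cast at h ⊢
    omega
  rw [← neg_one_mul, S.nu_mul, h2, zero_add]

/-- The fractional ideal `p_E^n`, as an additive subgroup of `E`. -/
def fracIdeal (S : USetting E) (n : ℤ) : AddSubgroup E where
  carrier := {x | (n : WithTop ℤ) ≤ S.nu x}
  add_mem' {x y} hx hy := (le_min hx hy).trans (S.nu_add x y)
  zero_mem' := by simp [(S.nu_eq_top 0).2 rfl]
  neg_mem' {x} hx := by simpa [nu_neg] using hx

theorem mem_fracIdeal {n : ℤ} {x : E} : x ∈ S.fracIdeal n ↔ (n : WithTop ℤ) ≤ S.nu x := Iff.rfl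

theorem mem_fracIdeal_zero {x : E} : x ∈ S.fracIdeal 0 ↔ 0 ≤ S.nu x := Iff.rfl

theorem mem_fracIdeal_one {x : E} : x ∈ S.fracIdeal 1 ↔ 1 ≤ S.nu x := Iff.rfl

theorem fracIdeal_anti {m n : ℤ} (h : m ≤ n) {x : E} (hx : x ∈ S.fracIdeal n) :
    x ∈ S.fracIdeal m :=
  le_trans (WithTop.coe_le_coe.2 h) hx

theorem mul_mem_add {m n : ℤ} {x y : E} (hx : x ∈ S.fracIdeal m) (hy : y ∈ S.fracIdeal n) :
    x * y ∈ S.fracIdeal (m + n) := by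
  rw [mem_fracIdeal, S.nu_mul, WithTop.coe_add]
  exact add_le_add hx hy

theorem mul_mem_left {n : ℤ} {x y : E} (hx : x ∈ S.fracIdeal 0) (hy : y ∈ S.fracIdeal n) :
    x * y ∈ S.fracIdeal n := by
  simpa using mul_mem_add hx hy

theorem mul_mem_right {n : ℤ} {x y : E} (hx : x ∈ S.fracIdeal n) (hy : y ∈ S.fracIdeal 0) :
    x * y ∈ S.fracIdeal n := by
  simpa using mul_mem_add hx hy

theorem sig_mem {n : ℤ} {x : E} (hx : x ∈ S.fracIdeal n) : S.sig x ∈ S.fracIdeal n := by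
  rwa [mem_fracIdeal, S.nu_sig]

theorem one_mem : (1 : E) ∈ S.fracIdeal 0 := by rw [mem_fracIdeal_zero, nu_one]

theorem ne_zero_of_nu {n : ℤ} {x : E} (h : S.nu x = n) : x ≠ 0 := by
  rintro rfl
  rw [(S.nu_eq_top 0).2 rfl] at h
  exact WithTop.top_ne_coe h

theorem ne_zero_of_unit {x : E} (h : S.nu x = 0) : x ≠ 0 := ne_zero_of_nu (n := 0) h

theorem nu_inv {n : ℤ} {x : E} (h : S.nu x = n) : S.nu x⁻¹ = ((-n : ℤ) : WithTop ℤ) := by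
  have h1 := S.nu_mul x x⁻¹
  have h0 : S.nu x⁻¹ ≠ ⊤ := fun h' => ne_zero_of_nu h (by simpa using (S.nu_eq_top _).1 h')
  rw [mul_inv_cancel₀ (ne_zero_of_nu h), nu_one, h] at h1
  lift S.nu x⁻¹ to ℤ using h0 with a
  norm_cast at h1 ⊢
  omega

theorem nu_inv_unit {x : E} (h : S.nu x = 0) : S.nu x⁻¹ = 0 := nu_inv (n := 0) h

theorem nu_mul_unit {x y : E} (hx : S.nu x = 0) (hy : S.nu y = 0) : S.nu (x * y) = 0 := by
  rw [S.nu_mul, hx, hy, add_zero]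

theorem nu_mul_left_unit {x : E} (hx : S.nu x = 0) (y : E) : S.nu (x * y) = S.nu y := by
  rw [S.nu_mul, hx, zero_add]

theorem unit_mem {x : E} (hx : S.nu x = 0) : x ∈ S.fracIdeal 0 := hx.ge

theorem unit_of_mul_unit {x y : E} (hx : x ∈ S.fracIdeal 0) (hy : y ∈ S.fracIdeal 0)
    (h : S.nu (x * y) = 0) : S.nu x = 0 := by
  rw [S.nu_mul] at h
  rw [mem_fracIdeal_zero] at hx hy
  have h1 : S.nu x ≠ ⊤ := fun h' => by simp [h'] at h
  have h2 : S.nu y ≠ ⊤ := fun h' => by simp [h'] at h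
  lift S.nu x to ℤ using h1 with a
  lift S.nu y to ℤ using h2 with b
  norm_cast at *
  omega

theorem nu_pow (n : ℕ) : S.nu (S.pi ^ n) = ((n : ℤ) : WithTop ℤ) := by
  induction n with
  | zero => simpa using nu_one
  | succ n ih => rw [pow_succ, S.nu_mul, ih, S.nu_pi]; norm_cast

/-- The truncated valuation is unchanged under congruences modulo the truncation level. -/
theorem min_nu_eq {n : ℤ} {x y : E} (h : x - y ∈ S.fracIdeal n) :
    min (S.nu x) n = min (S.nu y) n := by
  have key : ∀ x y : E, x - y ∈ S.fracIdeal n → min (S.nu x) n ≤ min (S.nu y) n := by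
    intro x y h
    refine le_min ?_ (min_le_right _ _)
    have h1 := S.nu_add x (-(x - y))
    rw [nu_neg, neg_sub, add_sub_cancel] at h1
    exact (min_le_min_left _ h).trans h1
  exact le_antisymm (key x y h) (key y x (by simpa using neg_mem h))

theorem nu_eq_zero_iff_of_sub {x y : E} (h : x - y ∈ S.fracIdeal 1) (hy : S.nu y = 0) :
    S.nu x = 0 := by
  have h1 := min_nu_eq h
  rw [hy] at h1
  rcases le_total (S.nu x) ((1 : ℤ) : WithTop ℤ) with h2 | h2
  · rw [min_eq_left h2] at h1
    rw [h1]; rfl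
  · rw [min_eq_right h2] at h1
    exact absurd h1 (by decide)

theorem half_mem {n : ℤ} {x : E} (hx : x ∈ S.fracIdeal n) : x / 2 ∈ S.fracIdeal n := by
  rw [div_eq_mul_inv]
  exact mul_mem_right hx (unit_mem (nu_inv_unit S.nu_two))

theorem two_ne_zero' (S : USetting E) : (2 : E) ≠ 0 := ne_zero_of_unit S.nu_two

theorem sqeps_ne_zero (S : USetting E) : S.sqeps ≠ 0 := ne_zero_of_unit S.nu_sqeps

theorem pi_ne_zero (S : USetting E) : S.pi ≠ 0 := ne_zero_of_nu (n := 1) S.nu_pi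

end USetting

/-- Characters trivial on `1 + p_E^n` only depend on units modulo `p_E^n`. -/
theorem IsChar.congr {S : USetting E} {χ : E → ℂ} (hχ : IsChar χ) {n : ℤ}
    (ht : TrivOn χ (onePE S n)) {x y : E} (hx : x ≠ 0) (hy : S.nu y = 0)
    (h : x - y ∈ S.fracIdeal n) : χ x = χ y := by
  have hy0 := USetting.ne_zero_of_unit hy
  have h1 : x = x / y * y := by field_simp
  have h2 : χ (x / y) = 1 := by
    refine ht _ ?_
    have : x / y - 1 = (x - y) * y⁻¹ := by field_simp
    rw [onePE, Set.mem_ofPred_eq, this]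
    exact USetting.mul_mem_right h (USetting.unit_mem (USetting.nu_inv_unit hy))
  rw [h1, hχ.1 _ _ (div_ne_zero hx hy0) hy0, h2, one_mul]

theorem IsChar.one {χ : E → ℂ} (hχ : IsChar χ) : χ 1 = 1 := by
  have h := hχ.1 1 1 one_ne_zero one_ne_zero
  rw [mul_one] at h
  exact (mul_eq_left₀ (hχ.2 1 one_ne_zero)).1 h.symm

theorem IsChar.inv {χ : E → ℂ} (hχ : IsChar χ) {x : E} (hx : x ≠ 0) : χ x⁻¹ = (χ x)⁻¹ := by
  have h := hχ.1 x x⁻¹ hx (inv_ne_zero hx)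
  rw [mul_inv_cancel₀ hx, hχ.one] at h
  exact eq_inv_of_mul_eq_one_right h.symm

namespace USetting

/-- The ring of integers `O_F`, as a subring of `E`. -/
def OF (S : USetting E) : Subring E where
  carrier := {x | S.sig x = x ∧ x ∈ S.fracIdeal 0}
  mul_mem' := fun ⟨h1, h2⟩ ⟨h3, h4⟩ => ⟨by rw [map_mul, h1, h3], mul_mem_left h2 h4⟩
  one_mem' := ⟨map_one _, one_mem⟩
  add_mem' := fun ⟨h1, h2⟩ ⟨h3, h4⟩ => ⟨by rw [map_add, h1, h3], add_mem h2 h4⟩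
  zero_mem' := ⟨map_zero _, zero_mem _⟩
  neg_mem' := fun ⟨h1, h2⟩ => ⟨by rw [map_neg, h1], neg_mem h2⟩

/-- The maximal ideal `p_F` of `O_F`. -/
def pF (S : USetting E) : Ideal S.OF where
  carrier := {x | (x : E) ∈ S.fracIdeal 1}
  add_mem' h1 h2 := (S.fracIdeal 1).add_mem h1 h2
  zero_mem' := zero_mem (S.fracIdeal 1)
  smul_mem' c _ hx := mul_mem_left c.2.2 hx

variable {S : USetting E}

theorem mem_pF {x : S.OF} : x ∈ S.pF ↔ (x : E) ∈ S.fracIdeal 1 := Iff.rfl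

theorem mem_one_of_not_unit {x : E} (hx : x ∈ S.fracIdeal 0) (h : S.nu x ≠ 0) :
    x ∈ S.fracIdeal 1 := by
  rw [mem_fracIdeal_zero] at hx
  rw [mem_fracIdeal_one]
  rcases eq_or_ne (S.nu x) ⊤ with h' | h'
  · simp [h']
  lift S.nu x to ℤ using h' with a
  norm_cast at *
  omega

theorem not_mem_one_of_unit {x : E} (h : S.nu x = 0) : x ∉ S.fracIdeal 1 := by
  rw [mem_fracIdeal_one, h]
  decide

instance : (S.pF).IsPrime where
  ne_top' := by
    rw [Ideal.ne_top_iff_one, mem_pF]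
    exact not_mem_one_of_unit nu_one
  mem_or_mem' {x y} h := by
    rw [mem_pF] at h
    by_contra! h'
    simp only [mem_pF] at h'
    refine not_mem_one_of_unit (nu_mul_unit ?_ ?_) h
    · exact by_contra fun h1 => h'.1 (mem_one_of_not_unit x.2.2 h1)
    · exact by_contra fun h1 => h'.2 (mem_one_of_not_unit y.2.2 h1)

instance : Finite (S.OF ⧸ S.pF) := by
  obtain ⟨R, -, hR, hR'⟩ := S.res_card
  refine Finite.of_surjective
    (fun x : R => Ideal.Quotient.mk S.pF ⟨x, (hR x x.2).1, (hR x x.2).2⟩) ?_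
  intro y
  obtain ⟨y, rfl⟩ := Ideal.Quotient.mk_surjective y
  obtain ⟨x, ⟨hx, hxy⟩, -⟩ := hR' y y.2.1 y.2.2
  refine ⟨⟨x, hx⟩, (Ideal.Quotient.eq.2 ?_).symm⟩
  exact hxy

theorem residue_card_odd [Fintype (S.OF ⧸ S.pF)] : Fintype.card (S.OF ⧸ S.pF) % 2 = 1 := by
  by_contra h
  obtain ⟨x, hx⟩ := exists_prime_addOrderOf_dvd_card (G := S.OF ⧸ S.pF) 2 (by omega)
  have h1 : (2 : ℕ) • x = 0 := hx ▸ addOrderOf_nsmul_eq_zero x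
  have h2 : (2 : S.OF ⧸ S.pF) ≠ 0 := by
    intro h2
    have : (2 : S.OF) ∈ S.pF := Ideal.Quotient.eq_zero_iff_mem.1 ((map_ofNat _ 2).trans h2)
    exact not_mem_one_of_unit S.nu_two this
  rw [nsmul_eq_mul] at h1
  have h3 : x = 0 := (mul_eq_zero.1 h1).resolve_left (by exact_mod_cast h2)
  rw [h3, addOrderOf_zero] at hx
  omega

open Polynomial in
theorem exists_norm_sub_mem_one {y : E} (hy : S.sig y = y) (hy0 : S.nu y = 0) :
    ∃ a, S.nu a = 0 ∧ a * S.sig a - y ∈ S.fracIdeal 1 := by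
  have := Fintype.ofFinite (S.OF ⧸ S.pF)
  let Y : S.OF := ⟨y, hy, unit_mem hy0⟩
  let e : S.OF := ⟨S.sqeps * S.sqeps, by simp [S.sig_sqeps],
    unit_mem (nu_mul_unit S.nu_sqeps S.nu_sqeps)⟩
  let m := Ideal.Quotient.mk S.pF
  have he : m e ≠ 0 := by
    intro h
    exact not_mem_one_of_unit (nu_mul_unit S.nu_sqeps S.nu_sqeps)
      (Ideal.Quotient.eq_zero_iff_mem.1 h)
  obtain ⟨s, t, hst⟩ := FiniteField.exists_root_sum_quadratic
    (f := X ^ 2 - C (m Y)) (g := C (-m e) * X ^ 2)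
    (degree_X_pow_sub_C (by norm_num) _) (degree_C_mul_X_pow 2 (neg_ne_zero.2 he))
    residue_card_odd
  obtain ⟨s, rfl⟩ := Ideal.Quotient.mk_surjective s
  obtain ⟨t, rfl⟩ := Ideal.Quotient.mk_surjective t
  have h : s ^ 2 - Y + -e * t ^ 2 ∈ S.pF := by
    rw [← Ideal.Quotient.eq_zero_iff_mem]
    simpa [m] using hst
  have hN : ((s : E) + t * S.sqeps) * S.sig (s + t * S.sqeps) - y ∈ S.fracIdeal 1 := by
    have h1 : ((s : E) + t * S.sqeps) * S.sig (s + t * S.sqeps) - y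
        = ((s ^ 2 - Y + -e * t ^ 2 : S.OF) : E) := by
      have hs : S.sig s = s := s.2.1
      have ht : S.sig t = t := t.2.1
      simp only [map_add, map_mul, hs, ht, S.sig_sqeps]
      push_cast
      ring
    rw [h1]
    exact h
  have hint : (s : E) + t * S.sqeps ∈ S.fracIdeal 0 :=
    add_mem s.2.2 (mul_mem_left t.2.2 (unit_mem S.nu_sqeps))
  exact ⟨_, unit_of_mul_unit hint (sig_mem hint) (nu_eq_zero_iff_of_sub hN hy0), hN⟩

/-- Units of `O_F` are norms from `O_E^×` modulo every power of `p_F`. -/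
theorem exists_norm_sub_mem {y : E} (hy : S.sig y = y) (hy0 : S.nu y = 0) (n : ℕ) :
    ∃ a, S.nu a = 0 ∧ a * S.sig a - y ∈ S.fracIdeal (n + 1) := by
  induction n with
  | zero => simpa using exists_norm_sub_mem_one hy hy0
  | succ n ih =>
    obtain ⟨a, ha, h⟩ := ih
    set N := a * S.sig a with hN
    have hNu : S.nu N = 0 := nu_mul_unit ha (by rw [S.nu_sig, ha])
    have hN0 := ne_zero_of_unit hNu
    have hsN : S.sig N = N := by rw [hN, map_mul, S.sig_invol, mul_comm]
    set x := (y - N) * N⁻¹ with hx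
    have hxm : x ∈ S.fracIdeal (n + 1) :=
      mul_mem_right (by simpa using neg_mem h) (unit_mem (nu_inv_unit hNu))
    have hsx : S.sig x = x := by simp [hx, hy, hsN]
    have h2 := S.two_ne_zero'
    have hu : S.nu (1 + x / 2) = 0 := by
      refine nu_eq_zero_iff_of_sub (y := 1) ?_ nu_one
      rw [add_sub_cancel_left]
      exact fracIdeal_anti (by omega) (half_mem hxm)
    refine ⟨a * (1 + x / 2), nu_mul_unit ha hu, ?_⟩
    have key : a * (1 + x / 2) * S.sig (a * (1 + x / 2)) - y = N * (x / 2 * (x / 2)) := by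
      have h1 : a * (1 + x / 2) * S.sig (a * (1 + x / 2)) = N * (1 + x / 2) ^ 2 := by
        simp only [map_mul, map_add, map_one, map_div₀, hsx, map_ofNat, hN]
        ring
      have h3 : y = N + N * x := by rw [hx]; field_simp; ring
      have h4 : x = 2 * (x / 2) := by field_simp
      linear_combination h1 - h3 - N * h4
    rw [key]
    refine mul_mem_left (unit_mem hNu) (fracIdeal_anti ?_ (mul_mem_add (half_mem hxm) (half_mem hxm)))
    push_cast
    omega

theorem exists_pi_mul {n : ℕ} {x : E} (hx : x ∈ S.fracIdeal n) :
    ∃ y ∈ S.fracIdeal 0, x = S.pi ^ n * y := by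
  have h := pow_ne_zero n S.pi_ne_zero
  refine ⟨(S.pi ^ n)⁻¹ * x, ?_, by field_simp⟩
  simpa using mul_mem_add (nu_inv (nu_pow n)).ge hx

theorem exists_finite_reps_OF (n : ℕ) : ∃ R : Set E, R.Finite ∧
    ∀ x, S.sig x = x → x ∈ S.fracIdeal 0 → ∃ y ∈ R, S.sig y = y ∧ x - y ∈ S.fracIdeal n := by
  induction n with
  | zero =>
    exact ⟨{0}, Set.finite_singleton _, fun x _ hx => ⟨0, rfl, map_zero _, by simpa using hx⟩⟩
  | succ n ih =>
    obtain ⟨R, hR, h⟩ := ih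
    obtain ⟨R₁, -, h₁, h₁'⟩ := S.res_card
    refine ⟨Set.image2 (fun y z => y + S.pi ^ n * z) R R₁, hR.image2 _ R₁.finite_toSet, ?_⟩
    intro x hsx hx
    obtain ⟨y, hy, hsy, hxy⟩ := h x hsx hx
    obtain ⟨z, hz, hxyz⟩ := exists_pi_mul hxy
    have h0 := pow_ne_zero n S.pi_ne_zero
    have hsz : S.sig z = z := by
      have := congrArg S.sig hxyz
      rw [map_sub, hsx, hsy, map_mul, map_pow, S.sig_pi, hxyz] at this
      exact (mul_left_cancel₀ h0 this).symm
    obtain ⟨w, ⟨hw, hzw⟩, -⟩ := h₁' z hsz hz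
    refine ⟨_, ⟨y, hy, w, hw, rfl⟩, ?_, ?_⟩
    · simp [hsy, S.sig_pi, (h₁ w hw).1]
    · have : x - (y + S.pi ^ n * w) = S.pi ^ n * (z - w) := by linear_combination hxyz
      rw [this]
      push_cast
      exact mul_mem_add (nu_pow n).ge hzw

theorem gen_integral {x : E} (hx : x ∈ S.fracIdeal 0) : ∃ a b, S.sig a = a ∧ S.sig b = b ∧
    a ∈ S.fracIdeal 0 ∧ b ∈ S.fracIdeal 0 ∧ x = a + b * S.sqeps := by
  obtain ⟨a, b, ha, hb, rfl⟩ := S.gen x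
  have h2 := S.two_ne_zero'
  have h3 := S.sqeps_ne_zero
  have h4 : S.sig (a + b * S.sqeps) = a - b * S.sqeps := by
    simp [ha, hb, S.sig_sqeps, sub_eq_add_neg]
  refine ⟨a, b, ha, hb, ?_, ?_, rfl⟩
  · have h5 := half_mem (add_mem hx (sig_mem hx))
    rw [h4] at h5
    convert h5 using 1
    field_simp
    ring
  · have h5 := mul_mem_right (half_mem (sub_mem hx (sig_mem hx)))
      (unit_mem (nu_inv_unit S.nu_sqeps))
    rw [h4] at h5
    convert h5 using 1
    field_simp
    ring

/-- `O_E / p_E^n` is finite. -/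
theorem exists_finite_reps (n : ℕ) : ∃ R : Set E, R.Finite ∧
    ∀ x ∈ S.fracIdeal 0, ∃ y ∈ R, x - y ∈ S.fracIdeal n := by
  obtain ⟨R, hR, h⟩ := exists_finite_reps_OF (S := S) n
  refine ⟨Set.image2 (fun y z => y + z * S.sqeps) R R, hR.image2 _ hR, fun x hx => ?_⟩
  obtain ⟨a, b, ha, hb, ha', hb', rfl⟩ := gen_integral hx
  obtain ⟨y, hy, -, hay⟩ := h a ha ha'
  obtain ⟨z, hz, -, hbz⟩ := h b hb hb'
  refine ⟨_, ⟨y, hy, z, hz, rfl⟩, ?_⟩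
  have : a + b * S.sqeps - (y + z * S.sqeps) = (a - y) + (b - z) * S.sqeps := by ring
  rw [this]
  exact add_mem hay (mul_mem_right hbz (unit_mem S.nu_sqeps))

end USetting

section Induced

variable {G : Type*} [Group G] (H : Subgroup G) (χ : G → ℂ)

/-- The functions on `G` that are left `H`-equivariant with respect to `χ`. -/
def IndV : Submodule ℂ (G → ℂ) where
  carrier := {f | ∀ h ∈ H, ∀ g, f (h * g) = χ h * f g}
  add_mem' hf hg h hh g := by simp only [Pi.add_apply, hf h hh g, hg h hh g, mul_add]
  zero_mem' h _ g := by simp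
  smul_mem' c f hf h hh g := by simp only [Pi.smul_apply, hf h hh g, smul_eq_mul]; ring

/-- The functions on `G` that are `H`-equivariant with respect to `χ` on both sides. -/
def HeckeSp : Submodule ℂ (G → ℂ) where
  carrier := {f | f ∈ IndV H χ ∧ ∀ h ∈ H, ∀ g, f (g * h) = χ h * f g}
  add_mem' hf hg := ⟨add_mem hf.1 hg.1, fun h hh g => by
    simp only [Pi.add_apply, hf.2 h hh g, hg.2 h hh g, mul_add]⟩
  zero_mem' := ⟨zero_mem _, fun h _ g => by simp⟩
  smul_mem' c f hf := ⟨Submodule.smul_mem _ c hf.1, fun h hh g => by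
    simp only [Pi.smul_apply, hf.2 h hh g, smul_eq_mul]; ring⟩

open Classical in
/-- The element of `IndV H χ` supported on `H` with value `1` at `1`. -/
def indDelta (k : G) : ℂ := if k ∈ H then χ k else 0

/-- The convolution of `f` with `φ` over `G ⧸ H`. -/
def indConv [Fintype (G ⧸ H)] (φ f : G → ℂ) (k : G) : ℂ :=
  ∑ x : G ⧸ H, f x.out⁻¹ * φ (k * x.out)

variable {H χ}

theorem char_inv_mul (hmul : ∀ h ∈ H, ∀ h' ∈ H, χ (h * h') = χ h * χ h')
    (hne : ∀ h ∈ H, χ h ≠ 0) {h : G} (hh : h ∈ H) : χ h⁻¹ * χ h = 1 := by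
  have h1 : χ 1 = 1 := by
    have := hmul 1 H.one_mem 1 H.one_mem
    rw [mul_one] at this
    exact (mul_eq_left₀ (hne 1 H.one_mem)).1 this.symm
  rw [← hmul _ (H.inv_mem hh) _ hh, inv_mul_cancel, h1]

theorem indDelta_mem (hmul : ∀ h ∈ H, ∀ h' ∈ H, χ (h * h') = χ h * χ h') :
    indDelta H χ ∈ HeckeSp H χ := by
  refine ⟨fun h hh g => ?_, fun h hh g => ?_⟩
  · by_cases hg : g ∈ H
    · simp [indDelta, H.mul_mem_cancel_left hh, hg, hmul h hh g hg]
    · simp [indDelta, H.mul_mem_cancel_left hh, hg]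
  · by_cases hg : g ∈ H
    · simp [indDelta, H.mul_mem_cancel_right hh, hg, hmul g hg h hh, mul_comm]
    · simp [indDelta, H.mul_mem_cancel_right hh, hg]

variable [Fintype (G ⧸ H)]

theorem indConv_add (φ f f' : G → ℂ) (k : G) :
    indConv H φ (fun x => f x + f' x) k = indConv H φ f k + indConv H φ f' k := by
  simp only [indConv, add_mul, Finset.sum_add_distrib]

theorem indConv_smul (φ f : G → ℂ) (c : ℂ) (k : G) :
    indConv H φ (fun x => c * f x) k = c * indConv H φ f k := by
  simp only [indConv, mul_assoc, Finset.mul_sum]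

theorem sum_out_mul_left {F : G → ℂ} (hF : ∀ h ∈ H, ∀ g, F (g * h) = F g) (g : G) :
    ∑ x : G ⧸ H, F (g * x.out) = ∑ x : G ⧸ H, F x.out := by
  refine Fintype.sum_equiv (MulAction.toPerm g) _ _ fun x => ?_
  have h1 : MulAction.toPerm g x = ((g * x.out : G) : G ⧸ H) := by
    conv_lhs => rw [← x.out_eq']
    rfl
  obtain ⟨h, hh⟩ := QuotientGroup.mk_out_eq_mul H (g * x.out)
  rw [h1, hh, hF h h.2]

theorem indConv_mul_right (hmul : ∀ h ∈ H, ∀ h' ∈ H, χ (h * h') = χ h * χ h')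
    (hne : ∀ h ∈ H, χ h ≠ 0) {φ f : G → ℂ} (hφ : φ ∈ HeckeSp H χ) (hf : f ∈ IndV H χ) (g k : G) :
    indConv H φ (fun x => f (x * g)) k = indConv H φ f (k * g) := by
  unfold indConv
  rw [← sum_out_mul_left (F := fun y => f (y⁻¹ * g) * φ (k * y)) _ g]
  · refine Finset.sum_congr rfl fun x _ => ?_
    simp [mul_assoc]
  · intro h hh y
    have h1 := hf h⁻¹ (H.inv_mem hh) (y⁻¹ * g)
    have h2 := hφ.2 h hh (k * y)
    simp only [_root_.mul_inv_rev, mul_assoc] at h1 h2 ⊢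
    rw [h1, h2]
    linear_combination (f (y⁻¹ * g) * φ (k * y)) * char_inv_mul hmul hne hh

theorem indConv_mem {φ : G → ℂ} (hφ : φ ∈ HeckeSp H χ) (f : G → ℂ) : indConv H φ f ∈ IndV H χ := by
  intro h hh g
  simp only [indConv, Finset.mul_sum]
  refine Finset.sum_congr rfl fun x _ => ?_
  rw [mul_assoc, hφ.1 h hh]
  ring

theorem indConv_delta_right (hmul : ∀ h ∈ H, ∀ h' ∈ H, χ (h * h') = χ h * χ h')
    (hne : ∀ h ∈ H, χ h ≠ 0) {φ : G → ℂ} (hφ : φ ∈ HeckeSp H χ) :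
    indConv H φ (indDelta H χ) = φ := by
  funext k
  unfold indConv
  rw [Finset.sum_eq_single ((1 : G) : G ⧸ H)]
  · obtain ⟨h, hh⟩ := QuotientGroup.mk_out_eq_mul H 1
    rw [one_mul] at hh
    rw [hh, hφ.2 h h.2, indDelta, if_pos (H.inv_mem h.2)]
    linear_combination φ k * char_inv_mul hmul hne h.2
  · intro x _ hx
    rw [indDelta, if_neg, zero_mul]
    intro h
    apply hx
    rw [← x.out_eq']
    exact QuotientGroup.eq.2 (by simpa using h)
  · simp

theorem indConv_delta_left (hmul : ∀ h ∈ H, ∀ h' ∈ H, χ (h * h') = χ h * χ h')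
    (hne : ∀ h ∈ H, χ h ≠ 0) {f : G → ℂ} (hf : f ∈ IndV H χ) :
    indConv H (indDelta H χ) f = f := by
  funext k
  unfold indConv
  rw [Finset.sum_eq_single ((k⁻¹ : G) : G ⧸ H)]
  · obtain ⟨h, hh⟩ := QuotientGroup.mk_out_eq_mul H k⁻¹
    rw [hh, _root_.mul_inv_rev, inv_inv, hf _ (H.inv_mem h.2), mul_inv_cancel_left, indDelta, if_pos h.2]
    linear_combination f k * char_inv_mul hmul hne h.2
  · intro x _ hx
    rw [indDelta, if_neg, mul_zero]
    intro h
    apply hx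
    rw [← x.out_eq']
    refine (QuotientGroup.eq.2 ?_).symm
    simpa using h
  · simp

end Induced

section UnitaryGroup

open USetting

variable {S : USetting E}

theorem mem_Gset_iff {g : Mat E} : g ∈ Gset S ↔
    S.sig (g 1 0) * g 0 0 + S.sig (g 0 0) * g 1 0 = 0 ∧
    S.sig (g 1 0) * g 0 1 + S.sig (g 0 0) * g 1 1 = 1 ∧
    S.sig (g 1 1) * g 0 0 + S.sig (g 0 1) * g 1 0 = 1 ∧
    S.sig (g 1 1) * g 0 1 + S.sig (g 0 1) * g 1 1 = 0 := by
  change _ = _ ↔ _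
  rw [← Matrix.ext_iff]
  simp [Fin.forall_fin_two, Matrix.mul_apply, Fin.sum_univ_two, w0, and_assoc]

theorem mem_Kset_iff {g : Mat E} : g ∈ Kset S ↔ g ∈ Gset S ∧ ∀ i j, g i j ∈ S.fracIdeal 0 := by
  refine ⟨fun h => ⟨h.1, h.2.1⟩, fun h => ⟨h.1, h.2, ?_⟩⟩
  obtain ⟨h1, h2, h3, h4⟩ := mem_Gset_iff.1 h.1
  have hdet : g.det ∈ S.fracIdeal 0 := by
    rw [Matrix.det_fin_two]
    exact sub_mem (mul_mem_left (h.2 _ _) (h.2 _ _)) (mul_mem_left (h.2 _ _) (h.2 _ _))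
  refine unit_of_mul_unit hdet (sig_mem hdet) ?_
  have : g.det * S.sig g.det = 1 := by
    rw [Matrix.det_fin_two, map_sub, map_mul, map_mul]
    linear_combination (-(S.sig (g 1 1) * g 0 1 + S.sig (g 0 1) * g 1 1)) * h1 +
      (S.sig (g 1 1) * g 0 0 + S.sig (g 0 1) * g 1 0) * h2 + h3
  rw [this, nu_one]

/-- The inverse of a unitary matrix. -/
def unitaryInv (S : USetting E) (g : Mat E) : Mat E :=
  !![S.sig (g 1 1), S.sig (g 0 1); S.sig (g 1 0), S.sig (g 0 0)]

theorem unitaryInv_mul {g : Mat E} (hg : g ∈ Gset S) : unitaryInv S g * g = 1 := by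
  obtain ⟨h1, h2, h3, h4⟩ := mem_Gset_iff.1 hg
  rw [← Matrix.ext_iff]
  simp [Fin.forall_fin_two, Matrix.mul_apply, Fin.sum_univ_two, unitaryInv, h1, h2, h3, h4]

theorem Gset_row {g : Mat E} (hg : g ∈ Gset S) :
    (g 0 0 * S.sig (g 1 1) + g 0 1 * S.sig (g 1 0) = 1 ∧
      g 0 0 * S.sig (g 0 1) + g 0 1 * S.sig (g 0 0) = 0) ∧
    g 1 0 * S.sig (g 1 1) + g 1 1 * S.sig (g 1 0) = 0 ∧
      g 1 0 * S.sig (g 0 1) + g 1 1 * S.sig (g 0 0) = 1 := by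
  have h := mul_eq_one_comm.1 (unitaryInv_mul hg)
  rw [← Matrix.ext_iff] at h
  simpa [Fin.forall_fin_two, Matrix.mul_apply, Fin.sum_univ_two, unitaryInv] using h

theorem unitaryInv_mem {g : Mat E} (hg : g ∈ Kset S) : unitaryInv S g ∈ Kset S := by
  obtain ⟨⟨h1, h2⟩, h3, h4⟩ := Gset_row hg.1
  refine mem_Kset_iff.2 ⟨mem_Gset_iff.2 ?_, ?_⟩
  · simp only [unitaryInv, Matrix.of_apply, Matrix.cons_val', Matrix.cons_val_zero,
      Matrix.cons_val_one, Matrix.cons_val_fin_one, S.sig_invol]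
    exact ⟨h3, h4, h1, h2⟩
  · have h := (mem_Kset_iff.1 hg).2
    simp [Fin.forall_fin_two, unitaryInv, sig_mem (h _ _)]

theorem mul_mem_Kset {g h : Mat E} (hg : g ∈ Kset S) (hh : h ∈ Kset S) : g * h ∈ Kset S := by
  refine mem_Kset_iff.2 ⟨?_, fun i j => ?_⟩
  · have h1 : (g.map S.sig)ᵀ * w0 E * g = w0 E := hg.1
    have h2 : (h.map S.sig)ᵀ * w0 E * h = w0 E := hh.1
    change ((g * h).map S.sig)ᵀ * w0 E * (g * h) = w0 E
    rw [Matrix.map_mul, Matrix.transpose_mul]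
    calc _ = (h.map S.sig)ᵀ * ((g.map S.sig)ᵀ * w0 E * g) * h := by simp only [Matrix.mul_assoc]
      _ = _ := by rw [h1, h2]
  · rw [Matrix.mul_apply]
    exact sum_mem fun k _ => mul_mem_left ((mem_Kset_iff.1 hg).2 _ _) ((mem_Kset_iff.1 hh).2 _ _)

theorem one_mem_Kset : (1 : Mat E) ∈ Kset S := by
  refine mem_Kset_iff.2 ⟨mem_Gset_iff.2 (by simp), ?_⟩
  simp [Fin.forall_fin_two, USetting.one_mem, zero_mem]

/-- `K` is a group under matrix multiplication. -/
instance : Group (Kset S) where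
  mul g h := ⟨g.1 * h.1, mul_mem_Kset g.2 h.2⟩
  one := ⟨1, one_mem_Kset⟩
  inv g := ⟨unitaryInv S g.1, unitaryInv_mem g.2⟩
  mul_assoc _ _ _ := Subtype.ext (Matrix.mul_assoc _ _ _)
  one_mul _ := Subtype.ext (Matrix.one_mul _)
  mul_one _ := Subtype.ext (Matrix.mul_one _)
  inv_mul_cancel g := Subtype.ext (unitaryInv_mul g.2.1)

theorem Kset_coe_mul (g h : Kset S) : (g * h).1 = g.1 * h.1 := rfl

theorem Kset_coe_inv (g : Kset S) : g⁻¹.1 = unitaryInv S g.1 := rfl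

theorem Kset_mul_apply (g h : Kset S) (i j : Fin 2) :
    (g * h).1 i j = g.1 i 0 * h.1 0 j + g.1 i 1 * h.1 1 j := by
  rw [Kset_coe_mul, Matrix.mul_apply, Fin.sum_univ_two]

theorem Kset_integral (g : Kset S) (i j : Fin 2) : g.1 i j ∈ S.fracIdeal 0 := g.2.2.1 i j

theorem Kset_mul_inv_apply (g h : Kset S) :
    (g * h⁻¹).1 1 0 = g.1 1 0 * S.sig (h.1 1 1) + g.1 1 1 * S.sig (h.1 1 0) := by
  rw [Kset_mul_apply]
  simp [Kset_coe_inv, unitaryInv]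

theorem Kset_inv_mul_apply (g h : Kset S) :
    (g⁻¹ * h).1 1 0 = S.sig (g.1 1 0) * h.1 0 0 + S.sig (g.1 0 0) * h.1 1 0 := by
  rw [Kset_mul_apply]
  simp [Kset_coe_inv, unitaryInv]

/-- The elements of `K` that are upper triangular modulo `p_E^d`. -/
def BK (S : USetting E) (d : ℕ) : Subgroup (Kset S) where
  carrier := {g | g.1 1 0 ∈ S.fracIdeal d}
  mul_mem' {g h} hg hh := by
    change (g * h).1 1 0 ∈ S.fracIdeal d
    rw [Kset_mul_apply]
    exact add_mem (mul_mem_right hg (Kset_integral _ _ _)) (mul_mem_left (Kset_integral _ _ _) hh)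
  one_mem' := zero_mem (S.fracIdeal d)
  inv_mem' {g} hg := sig_mem (x := g.1 1 0) hg

theorem mem_BK {d : ℕ} {g : Kset S} : g ∈ BK S d ↔ g.1 1 0 ∈ S.fracIdeal d := Iff.rfl

instance (d : ℕ) : Finite (Kset S ⧸ BK S d) := by
  obtain ⟨R, hR, h⟩ := exists_finite_reps (S := S) d
  have := hR.to_subtype
  choose! c hc hc' using h
  refine Finite.of_injective (β := Fin 2 → Fin 2 → R)
    (fun x i j => ⟨c (x.out.1 i j), hc _ (Kset_integral _ _ _)⟩) fun x y hxy => ?_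
  have hsub : ∀ i j, y.out.1 i j - x.out.1 i j ∈ S.fracIdeal d := by
    intro i j
    have h1 := congrFun (congrFun hxy i) j
    have h2 := sub_mem (hc' _ (Kset_integral y.out i j)) (hc' _ (Kset_integral x.out i j))
    simp only [Subtype.mk.injEq] at h1
    rwa [h1, sub_sub_sub_cancel_right] at h2
  rw [← x.out_eq', ← y.out_eq']
  refine QuotientGroup.eq.2 ?_
  rw [mem_BK, Kset_inv_mul_apply]
  have h0 := (mem_Gset_iff.1 x.out.2.1).1
  have : S.sig (x.out.1 1 0) * y.out.1 0 0 + S.sig (x.out.1 0 0) * y.out.1 1 0 =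
      S.sig (x.out.1 1 0) * (y.out.1 0 0 - x.out.1 0 0) +
        S.sig (x.out.1 0 0) * (y.out.1 1 0 - x.out.1 1 0) := by
    linear_combination h0
  rw [this]
  exact add_mem (mul_mem_left (sig_mem (Kset_integral _ _ _)) (hsub _ _))
    (mul_mem_left (sig_mem (Kset_integral _ _ _)) (hsub _ _))

theorem Kset_unit {g : Kset S} (hg : g.1 1 0 ∈ S.fracIdeal 1) :
    S.nu (g.1 0 0) = 0 ∧ S.nu (g.1 1 1) = 0 := by
  have h := (Gset_row g.2.1).1.1
  have h1 : S.nu (g.1 0 0 * S.sig (g.1 1 1)) = 0 := by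
    refine nu_eq_zero_iff_of_sub (y := 1) ?_ nu_one
    rw [← h, sub_add_cancel_left]
    exact neg_mem (mul_mem_left (Kset_integral _ _ _) (sig_mem hg))
  refine ⟨unit_of_mul_unit (Kset_integral _ _ _) (sig_mem (Kset_integral _ _ _)) h1, ?_⟩
  rw [← S.nu_sig]
  rw [mul_comm] at h1
  exact unit_of_mul_unit (sig_mem (Kset_integral _ _ _)) (Kset_integral _ _ _) h1

theorem BK_lower {d : ℕ} (hd : 1 ≤ d) {g : Kset S} (hg : g ∈ BK S d) : g.1 1 0 ∈ S.fracIdeal 1 :=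
  fracIdeal_anti (by omega) hg

/-- The upper left entry is multiplicative modulo `p_E^{r+1}` when the right factor is upper
triangular modulo `p_E^{r+1}`. -/
theorem char_mul_apply {χ : E → ℂ} (hχ : IsChar χ) {r : ℕ}
    (ht : TrivOn χ (onePE S ((r : ℤ) + 1))) {g h : Kset S} (hg : g.1 1 0 ∈ S.fracIdeal 1)
    (hh : h.1 1 0 ∈ S.fracIdeal (r + 1)) : χ ((g * h).1 0 0) = χ (g.1 0 0) * χ (h.1 0 0) := by
  have hg' := (Kset_unit hg).1
  have hh1 : h.1 1 0 ∈ S.fracIdeal 1 := fracIdeal_anti (by omega) hh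
  have hh' := (Kset_unit hh1).1
  have hgh : (g * h).1 1 0 ∈ S.fracIdeal 1 := by
    rw [Kset_mul_apply]
    exact add_mem (mul_mem_right hg (Kset_integral _ _ _)) (mul_mem_left (Kset_integral _ _ _) hh1)
  rw [← hχ.1 _ _ (ne_zero_of_unit hg') (ne_zero_of_unit hh')]
  refine hχ.congr ht (ne_zero_of_unit (Kset_unit hgh).1) (nu_mul_unit hg' hh') ?_
  rw [Kset_mul_apply, add_sub_cancel_left]
  exact mul_mem_left (Kset_integral _ _ _) hh

theorem char_BK_mul {χ : E → ℂ} (hχ : IsChar χ) {r d : ℕ}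
    (ht : TrivOn χ (onePE S ((r : ℤ) + 1))) (hd : r + 1 ≤ d) : ∀ g ∈ BK S d, ∀ h ∈ BK S d,
    χ ((g * h).1 0 0) = χ (g.1 0 0) * χ (h.1 0 0) := fun _ hg _ hh =>
  char_mul_apply hχ ht (BK_lower (by omega) hg) (fracIdeal_anti (by omega) hh)

theorem char_BK_ne_zero {χ : E → ℂ} (hχ : IsChar χ) {d : ℕ} (hd : 1 ≤ d) : ∀ g ∈ BK S d, χ (g.1 0 0) ≠ 0 := fun _ hg =>
  hχ.2 _ (ne_zero_of_unit (Kset_unit (BK_lower hd hg)).1)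

end UnitaryGroup

section DoubleCosets

open USetting

variable {S : USetting E}

/-- The valuation of the lower left entry, truncated at `d`. -/
def level (d : ℕ) (g : Kset S) : ℕ := ((min (S.nu (g.1 1 0)) ((d : ℤ) : WithTop ℤ)).untopD 0).toNat

theorem level_spec (d : ℕ) (g : Kset S) :
    (((level d g : ℕ) : ℤ) : WithTop ℤ) = min (S.nu (g.1 1 0)) ((d : ℤ) : WithTop ℤ) := by
  have h0 : ((0 : ℤ) : WithTop ℤ) ≤ min (S.nu (g.1 1 0)) ((d : ℤ) : WithTop ℤ) :=
    le_min (Kset_integral g 1 0) (by norm_cast; omega)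
  have h1 : min (S.nu (g.1 1 0)) ((d : ℤ) : WithTop ℤ) ≠ ⊤ :=
    ((min_le_right _ _).trans_lt (WithTop.coe_lt_top _)).ne
  unfold level
  lift min (S.nu (g.1 1 0)) ((d : ℤ) : WithTop ℤ) to ℤ using h1 with a
  rw [WithTop.coe_le_coe] at h0
  simp [h0]

theorem level_le (d : ℕ) (g : Kset S) : level d g ≤ d := by
  have := (level_spec d g).trans_le (min_le_right _ _)
  rw [WithTop.coe_le_coe] at this
  omega

theorem mem_fracIdeal_level (d : ℕ) (g : Kset S) : g.1 1 0 ∈ S.fracIdeal (level d g) :=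
  (level_spec d g).trans_le (min_le_left _ _)

theorem nu_of_level_lt {d : ℕ} {g : Kset S} (h : level d g < d) :
    S.nu (g.1 1 0) = ((level d g : ℤ) : WithTop ℤ) := by
  have h1 := level_spec d g
  rcases le_total (S.nu (g.1 1 0)) ((d : ℤ) : WithTop ℤ) with h2 | h2
  · rw [min_eq_left h2] at h1
    exact h1.symm
  · rw [min_eq_right h2, WithTop.coe_inj] at h1
    omega

theorem level_eq_of_nu {d i : ℕ} {g : Kset S} (hi : i ≤ d)
    (h : S.nu (g.1 1 0) = ((i : ℤ) : WithTop ℤ)) : level d g = i := by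
  have h1 := level_spec d g
  rw [h, min_eq_left (by rw [WithTop.coe_le_coe]; omega), WithTop.coe_inj] at h1
  omega

theorem level_congr {d : ℕ} {g h : Kset S} {u : E} (hu : S.nu u = 0)
    (hgh : g.1 1 0 - u * h.1 1 0 ∈ S.fracIdeal d) : level d g = level d h := by
  unfold level
  rw [min_nu_eq hgh, nu_mul_left_unit hu]

theorem level_mul_left {d : ℕ} (hd : 1 ≤ d) {h : Kset S} (hh : h ∈ BK S d) (g : Kset S) :
    level d (h * g) = level d g := by
  refine level_congr (Kset_unit (BK_lower hd hh)).2 ?_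
  rw [Kset_mul_apply, add_sub_cancel_right]
  exact mul_mem_right hh (Kset_integral _ _ _)

theorem level_mul_right {d : ℕ} (hd : 1 ≤ d) {h : Kset S} (hh : h ∈ BK S d) (g : Kset S) :
    level d (g * h) = level d g := by
  refine level_congr (Kset_unit (BK_lower hd hh)).1 ?_
  rw [Kset_mul_apply, mul_comm, add_sub_cancel_left]
  exact mul_mem_left (Kset_integral _ _ _) hh

/-- The Weyl element `w₀`. -/
def weyl (S : USetting E) : Kset S :=
  ⟨!![0, 1; 1, 0], mem_Kset_iff.2 ⟨mem_Gset_iff.2 (by simp), by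
    simp [Fin.forall_fin_two, USetting.one_mem, zero_mem]⟩⟩

/-- The lower unipotent element with entry `ϖ^i √ε`. -/
def lowerUnip (S : USetting E) (i : ℕ) : Kset S :=
  ⟨!![1, 0; S.pi ^ i * S.sqeps, 1], mem_Kset_iff.2 ⟨mem_Gset_iff.2 (by
    simp [S.sig_pi, S.sig_sqeps]), by
    have : S.pi ^ i * S.sqeps ∈ S.fracIdeal 0 :=
      mul_mem_right (fracIdeal_anti (by omega) (nu_pow i).ge) (unit_mem S.nu_sqeps)
    simp [Fin.forall_fin_two, USetting.one_mem, zero_mem, this]⟩⟩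

/-- Representatives of the double cosets of `BK S d` in `K`. -/
def cosetRep (S : USetting E) (i : ℕ) : Kset S := if i = 0 then weyl S else lowerUnip S i

/-- The diagonal element with upper left entry `a`. -/
def diagUnit (a : E) (ha : S.nu a = 0) : Kset S :=
  ⟨!![a, 0; 0, (S.sig a)⁻¹], mem_Kset_iff.2 ⟨mem_Gset_iff.2 (by
    have h0 := ne_zero_of_unit ha
    have h1 : S.sig a ≠ 0 := ne_zero_of_unit (by rw [S.nu_sig, ha])
    simp [S.sig_invol, h0, h1]), by
    have : (S.sig a)⁻¹ ∈ S.fracIdeal 0 := unit_mem (nu_inv_unit (by rw [S.nu_sig, ha]))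
    simp [Fin.forall_fin_two, zero_mem, unit_mem ha, this]⟩⟩

/-- The upper triangular element with diagonal `a, a⁻¹` for `a ∈ O_F^×`. -/
def upperTri (a b : E) (ha : S.nu a = 0) (hsa : S.sig a = a) (hb : b ∈ S.fracIdeal 0)
    (hsb : S.sig b = -b) : Kset S :=
  ⟨!![a, b; 0, a⁻¹], mem_Kset_iff.2 ⟨mem_Gset_iff.2 (by
    have h0 := ne_zero_of_unit ha
    simp [hsa, hsb, h0]
    ring), by
    simp [Fin.forall_fin_two, zero_mem, unit_mem ha, hb, unit_mem (nu_inv_unit ha)]⟩⟩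

theorem level_cosetRep {d i : ℕ} (hi : i ≤ d) : level d (cosetRep S i) = i := by
  refine level_eq_of_nu hi ?_
  unfold cosetRep
  split_ifs with h
  · subst h
    simpa [weyl] using nu_one
  · simp [lowerUnip, S.nu_mul, nu_pow, S.nu_sqeps]

/-- Every element of `K` lies in the double coset of its level. -/
theorem exists_eq_mul_cosetRep {d : ℕ} (hd : 1 ≤ d) (g : Kset S) : ∃ h ∈ BK S d, ∃ h' ∈ BK S d,
    g = h * cosetRep S (level d g) * h' := by
  have key : ∀ x : Kset S, (∃ h' ∈ BK S d, x = cosetRep S (level d g) * h') →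
      g.1 1 0 * S.sig (x.1 1 1) + g.1 1 1 * S.sig (x.1 1 0) ∈ S.fracIdeal d →
      ∃ h ∈ BK S d, ∃ h' ∈ BK S d, g = h * cosetRep S (level d g) * h' := by
    rintro x ⟨h', hh', rfl⟩ hx
    refine ⟨g * (cosetRep S (level d g) * h')⁻¹, ?_, h', hh', ?_⟩
    · rwa [mem_BK, Kset_mul_inv_apply]
    · rw [mul_assoc, inv_mul_cancel_right]
  have hrow := (Gset_row g.2.1).2.1
  rcases Nat.eq_zero_or_pos (level d g) with h0 | h0
  · have hc : S.nu (g.1 1 0) = 0 := by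
      rw [nu_of_level_lt (d := d) (by omega), h0]; rfl
    have hc0 := ne_zero_of_unit hc
    have hsc0 : S.sig (g.1 1 0) ≠ 0 := ne_zero_of_unit (by rw [S.nu_sig, hc])
    have hb : g.1 1 1 / g.1 1 0 ∈ S.fracIdeal 0 := by
      rw [div_eq_mul_inv]
      exact mul_mem_left (Kset_integral _ _ _) (unit_mem (nu_inv_unit hc))
    have hsb : S.sig (g.1 1 1 / g.1 1 0) = -(g.1 1 1 / g.1 1 0) := by
      rw [map_div₀]
      field_simp
      linear_combination hrow
    let u : Kset S := upperTri 1 (g.1 1 1 / g.1 1 0) nu_one (map_one _) hb hsb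
    refine key (cosetRep S (level d g) * u) ⟨u, zero_mem (S.fracIdeal d), rfl⟩ ?_
    rw [h0, Kset_mul_apply, Kset_mul_apply]
    have : g.1 1 0 * (S.sig (g.1 1 1) / S.sig (g.1 1 0)) + g.1 1 1 = 0 := by
      field_simp
      linear_combination hrow
    simp [cosetRep, weyl, u, upperTri, this, zero_mem]
  rcases (level_le d g).lt_or_eq with h1 | h1
  · have hc := nu_of_level_lt h1
    set i := level d g with hi
    have hcm := mem_fracIdeal_level d g
    have he := (Kset_unit (fracIdeal_anti (m := 1) (by omega) hcm)).2
    have he0 := ne_zero_of_unit he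
    have hse0 : S.sig (g.1 1 1) ≠ 0 := ne_zero_of_unit (by rw [S.nu_sig, he])
    have hp := pow_ne_zero i S.pi_ne_zero
    have hq := S.sqeps_ne_zero
    set t := g.1 1 0 * ((g.1 1 1)⁻¹ * ((S.pi ^ i)⁻¹ * S.sqeps⁻¹)) with htdef
    have htu : S.nu t = 0 := by
      rw [htdef, S.nu_mul, S.nu_mul, S.nu_mul, hc, nu_inv_unit he, nu_inv (nu_pow i),
        nu_inv_unit S.nu_sqeps]
      norm_cast
      simp
    have hts : S.sig t = t := by
      simp only [htdef, map_mul, map_inv₀, map_pow, S.sig_pi, S.sig_sqeps]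
      field_simp
      linear_combination -hrow
    obtain ⟨a, ha, hat⟩ := exists_norm_sub_mem hts htu d
    have ha0 := ne_zero_of_unit ha
    refine key (cosetRep S i * diagUnit a ha) ⟨diagUnit a ha, zero_mem (S.fracIdeal d), rfl⟩ ?_
    rw [Kset_mul_apply, Kset_mul_apply]
    simp only [cosetRep, if_neg h0.ne', lowerUnip, diagUnit, Matrix.of_apply, Matrix.cons_val',
      Matrix.cons_val_zero, Matrix.cons_val_one, Matrix.cons_val_fin_one, mul_zero, zero_add,
      one_mul, add_zero, map_inv₀, S.sig_invol, map_mul, map_pow, S.sig_pi, S.sig_sqeps]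
    have : g.1 1 0 * a⁻¹ + g.1 1 1 * (S.pi ^ i * -S.sqeps * S.sig a) =
        -(a⁻¹ * g.1 1 1 * (S.pi ^ i * S.sqeps)) * (a * S.sig a - t) := by
      rw [htdef]
      field_simp
      ring
    rw [this]
    refine mul_mem_left (neg_mem (mul_mem_left (mul_mem_left (unit_mem (nu_inv_unit ha))
      (unit_mem he)) (mul_mem_left ?_ (unit_mem S.nu_sqeps)))) (fracIdeal_anti (by omega) hat)
    exact fracIdeal_anti (by omega) (nu_pow i).ge
  · refine key (cosetRep S (level d g)) ⟨1, one_mem _, (mul_one _).symm⟩ ?_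
    have h2 := mem_fracIdeal_level d g
    have h3 := mem_fracIdeal_level d (cosetRep S (level d g))
    rw [level_cosetRep (level_le d g)] at h3
    rw [h1] at h2 h3 ⊢
    exact add_mem (mul_mem_right h2 (sig_mem (Kset_integral _ _ _)))
      (mul_mem_left (Kset_integral _ _ _) (sig_mem h3))

/-- The natural bi-equivariant extension of `χ` to the double cosets that support one. -/
def levelChar (χ : E → ℂ) (d : ℕ) (g : Kset S) : ℂ :=
  if level d g = 0 then χ (g.1 1 0) else χ (g.1 0 0)

/-- The set `s` of levels consists of levels whose double coset supports a bi-equivariant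
function. -/
def SupportsLevels (S : USetting E) (χ : E → ℂ) (r d : ℕ) (s : Finset ℕ) : Prop :=
  ∀ i ∈ s, i ≤ d ∧ (r + 1 ≤ i ∨ (i = 0 ∧ r = 0 ∧ ∀ x, S.nu x = 0 → χ (x * S.sig x) = 1))

theorem levelChar_mul {χ : E → ℂ} (hχ : IsChar χ) {r d : ℕ}
    (ht : TrivOn χ (onePE S ((r : ℤ) + 1))) (hd : r + 1 ≤ d) {s : Finset ℕ}
    (hs : SupportsLevels S χ r d s) {g h : Kset S} (hg : level d g ∈ s) (hh : h ∈ BK S d) :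
    levelChar χ d (h * g) = χ (h.1 0 0) * levelChar χ d g ∧
      levelChar χ d (g * h) = χ (h.1 0 0) * levelChar χ d g := by
  have hd1 : 1 ≤ d := by omega
  have hl := level_mul_left hd1 hh g
  have hr := level_mul_right hd1 hh g
  unfold levelChar
  rw [hl, hr]
  rcases (hs _ hg).2 with h1 | ⟨h1, rfl, h2⟩
  · rw [if_neg (by omega), if_neg (by omega), if_neg (by omega)]
    have h3 := mem_fracIdeal_level d g
    refine ⟨char_mul_apply hχ ht (BK_lower hd1 hh) (fracIdeal_anti (by omega) h3), ?_⟩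
    rw [char_mul_apply hχ ht (fracIdeal_anti (by omega) h3) (fracIdeal_anti (by omega) hh),
      mul_comm]
  · rw [if_pos h1, if_pos h1, if_pos h1]
    have nu_zero : ∀ k : Kset S, level d k = 0 → S.nu (k.1 1 0) = 0 := fun k hk => by
      rw [nu_of_level_lt (d := d) (by omega), hk]; rfl
    have hc := nu_zero g h1
    obtain ⟨ha, he⟩ := Kset_unit (BK_lower hd1 hh)
    have he' : S.nu (S.sig (h.1 1 1)) = 0 := by rw [S.nu_sig, he]
    have hae : χ (h.1 1 1) = χ (h.1 0 0) := by
      have h3 : χ (h.1 0 0 * S.sig (h.1 1 1)) = 1 := by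
        rw [← hχ.one]
        refine hχ.congr ht (ne_zero_of_unit (nu_mul_unit ha he')) nu_one ?_
        rw [← (Gset_row h.2.1).1.1, sub_add_cancel_left]
        exact neg_mem (mul_mem_left (Kset_integral _ _ _) (sig_mem (fracIdeal_anti (by omega) hh)))
      have h4 := h2 _ he
      rw [hχ.1 _ _ (ne_zero_of_unit ha) (ne_zero_of_unit he')] at h3
      rw [hχ.1 _ _ (ne_zero_of_unit he) (ne_zero_of_unit he'), ← h3] at h4
      exact mul_right_cancel₀ (hχ.2 _ (ne_zero_of_unit he')) h4
    constructor
    · rw [← hae, ← hχ.1 _ _ (ne_zero_of_unit he) (ne_zero_of_unit hc)]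
      refine hχ.congr ht (ne_zero_of_unit (nu_zero _ (hl.trans h1))) (nu_mul_unit he hc) ?_
      rw [Kset_mul_apply, add_sub_cancel_right]
      exact mul_mem_right (fracIdeal_anti (by omega) hh) (Kset_integral _ _ _)
    · rw [← hχ.1 _ _ (ne_zero_of_unit ha) (ne_zero_of_unit hc)]
      refine hχ.congr ht (ne_zero_of_unit (nu_zero _ (hr.trans h1))) (nu_mul_unit ha hc) ?_
      rw [Kset_mul_apply, mul_comm (g.1 1 0), add_sub_cancel_left]
      exact mul_mem_left (Kset_integral _ _ _) (fracIdeal_anti (by omega) hh)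

theorem levelChar_cosetRep {χ : E → ℂ} (hχ : IsChar χ) {d i : ℕ} (hi : i ≤ d) :
    levelChar χ d (cosetRep S i) = 1 := by
  unfold levelChar
  rw [level_cosetRep hi]
  split_ifs with h <;> simp [cosetRep, h, weyl, lowerUnip, hχ.one]

/-- The bi-equivariant functions on `K` have a basis indexed by the supported levels. -/
theorem finrank_HeckeSp {χ : E → ℂ} (hχ : IsChar χ) {r d : ℕ}
    (ht : TrivOn χ (onePE S ((r : ℤ) + 1))) (hd : r + 1 ≤ d) {s : Finset ℕ}
    (hs : SupportsLevels S χ r d s)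
    (hs' : ∀ i ≤ d, i ∉ s → ∀ φ ∈ HeckeSp (BK S d) (fun g => χ (g.1 0 0)), φ (cosetRep S i) = 0) :
    Module.finrank ℂ (HeckeSp (BK S d) (fun g => χ (g.1 0 0))) = s.card := by
  let ev : HeckeSp (BK S d) (fun g => χ (g.1 0 0)) →ₗ[ℂ] (s → ℂ) :=
    { toFun := fun φ i => φ.1 (cosetRep S i)
      map_add' := fun _ _ => rfl
      map_smul' := fun _ _ => rfl }
  have hd1 : 1 ≤ d := by omega
  have hbij : Function.Bijective ev := by
    constructor
    · rw [injective_iff_map_eq_zero]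
      intro φ hφ
      refine Subtype.ext (funext fun g => ?_)
      have h0 : φ.1 (cosetRep S (level d g)) = 0 := by
        by_cases hg : level d g ∈ s
        · exact congrFun hφ ⟨_, hg⟩
        · exact hs' _ (level_le d g) hg φ.1 φ.2
      obtain ⟨h, hh, h', hh', e⟩ := exists_eq_mul_cosetRep hd1 g
      rw [e, φ.2.2 h' hh', φ.2.1 h hh, h0]
      simp
    · intro v
      let w : ℕ → ℂ := fun i => if h : i ∈ s then v ⟨i, h⟩ else 0
      refine ⟨⟨fun g => w (level d g) * levelChar χ d g, fun h hh g => ?_, fun h hh g => ?_⟩, ?_⟩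
      · beta_reduce
        rw [level_mul_left hd1 hh]
        by_cases hg : level d g ∈ s
        · rw [(levelChar_mul hχ ht hd hs hg hh).1]
          ring
        · simp [w, hg]
      · beta_reduce
        rw [level_mul_right hd1 hh]
        by_cases hg : level d g ∈ s
        · rw [(levelChar_mul hχ ht hd hs hg hh).2]
          ring
        · simp [w, hg]
      · funext i
        have hi := (hs i i.2).1
        simp [ev, levelChar_cosetRep hχ hi, level_cosetRep hi, w]
  rw [(LinearEquiv.ofBijective ev hbij).finrank_eq]
  simp

theorem HeckeSp_weyl_eq_zero {χ : E → ℂ} (hχ : IsChar χ) {d : ℕ} {a : E} (ha : S.nu a = 0)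
    (h : χ (a * S.sig a) ≠ 1) {φ : Kset S → ℂ}
    (hφ : φ ∈ HeckeSp (BK S d) (fun g => χ (g.1 0 0))) : φ (weyl S) = 0 := by
  have hsa : S.nu (S.sig a) = 0 := by rw [S.nu_sig, ha]
  have e : diagUnit a ha * weyl S = weyl S * diagUnit (S.sig a)⁻¹ (nu_inv_unit hsa) := by
    refine Subtype.ext ?_
    simp only [Kset_coe_mul, diagUnit, weyl]
    simp [S.sig_invol]
  have h1 := hφ.1 (diagUnit a ha) (zero_mem (S.fracIdeal d)) (weyl S)
  have h2 := hφ.2 (diagUnit (S.sig a)⁻¹ (nu_inv_unit hsa)) (zero_mem (S.fracIdeal d)) (weyl S)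
  rw [e, h2] at h1
  by_contra h0
  have h3 := mul_right_cancel₀ h0 h1
  simp only [diagUnit, Matrix.of_apply, Matrix.cons_val', Matrix.cons_val_zero,
    Matrix.cons_val_fin_one] at h3
  rw [hχ.inv (ne_zero_of_unit hsa)] at h3
  apply h
  rw [hχ.1 _ _ (ne_zero_of_unit ha) (ne_zero_of_unit hsa), ← h3,
    inv_mul_cancel₀ (hχ.2 _ (ne_zero_of_unit hsa))]

theorem HeckeSp_lowerUnip_eq_zero {χ : E → ℂ} (hχ : IsChar χ) {d i : ℕ} {a : E} (hsa : S.sig a = a)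
    (ha : S.nu a = 0) (hai : a - 1 ∈ S.fracIdeal i) (h : χ (a * a) ≠ 1) {φ : Kset S → ℂ}
    (hφ : φ ∈ HeckeSp (BK S d) (fun g => χ (g.1 0 0))) : φ (lowerUnip S i) = 0 := by
  have ha0 := ne_zero_of_unit ha
  have hp := pow_ne_zero i S.pi_ne_zero
  have hq := S.sqeps_ne_zero
  set b := (a⁻¹ - a) * ((S.pi ^ i)⁻¹ * S.sqeps⁻¹) with hb
  have hsb : S.sig b = -b := by
    simp only [hb, map_mul, map_sub, map_inv₀, hsa, map_pow, S.sig_pi, S.sig_sqeps]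
    field_simp
  have hbm : b ∈ S.fracIdeal 0 := by
    have h1 : a⁻¹ - a = -((a - 1) * (a⁻¹ * (1 + a))) := by
      field_simp
      ring
    have h2 : a⁻¹ - a ∈ S.fracIdeal i := by
      rw [h1]
      exact neg_mem (mul_mem_right hai (mul_mem_left (unit_mem (nu_inv_unit ha))
        (add_mem USetting.one_mem (unit_mem ha))))
    have h3 := mul_mem_add h2 (mul_mem_right (nu_inv (nu_pow (S := S) i)).ge
      (unit_mem (nu_inv_unit S.nu_sqeps)))
    rwa [add_neg_cancel] at h3
  have hsa' : S.sig a⁻¹ = a⁻¹ := by rw [map_inv₀, hsa]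
  let x : Kset S := upperTri a b ha hsa hbm hsb
  let y : Kset S := upperTri a⁻¹ b (nu_inv_unit ha) hsa' hbm hsb
  have hbc : b * (S.pi ^ i * S.sqeps) = a⁻¹ - a := by
    rw [hb]
    field_simp
  have e : x * lowerUnip S i = lowerUnip S i * y := by
    refine Subtype.ext ?_
    simp only [Kset_coe_mul, x, y, upperTri, lowerUnip]
    simp
    exact ⟨by linear_combination hbc, mul_comm _ _, by linear_combination -hbc⟩
  have h1 := hφ.1 x (zero_mem (S.fracIdeal d)) (lowerUnip S i)
  have h2 := hφ.2 y (zero_mem (S.fracIdeal d)) (lowerUnip S i)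
  rw [e, h2] at h1
  by_contra h0
  have h3 := mul_right_cancel₀ h0 h1
  simp only [x, y, upperTri, Matrix.of_apply, Matrix.cons_val', Matrix.cons_val_zero,
    Matrix.cons_val_fin_one] at h3
  rw [hχ.inv ha0] at h3
  apply h
  rw [hχ.1 _ _ ha0 ha0]
  nth_rewrite 1 [← h3]
  exact inv_mul_cancel₀ (hχ.2 _ ha0)

end DoubleCosets

section Commutant

open USetting

variable {S : USetting E}

theorem conj_sub_one_mem {n : ℤ} {k : Kset S} (hk : ∀ i j, (k.1 - 1) i j ∈ S.fracIdeal n)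
    (g : Kset S) (i j : Fin 2) : ((g⁻¹ * k * g).1 - 1) i j ∈ S.fracIdeal n := by
  have h : (g⁻¹ * k * g).1 - 1 = g⁻¹.1 * (k.1 - 1) * g.1 := by
    have h1 : g⁻¹.1 * g.1 = 1 := unitaryInv_mul g.2.1
    rw [Kset_coe_mul, Kset_coe_mul, Matrix.mul_sub, Matrix.sub_mul, Matrix.mul_one, h1]
  rw [h, Matrix.mul_apply]
  refine sum_mem fun l _ => mul_mem_right ?_ (Kset_integral _ _ _)
  rw [Matrix.mul_apply]
  exact sum_mem fun l _ => mul_mem_left (Kset_integral _ _ _) (hk _ _)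

/-- Every element of `BK S d` is the product of an upper triangular element and an element
of `K_d`. -/
theorem exists_Bcal_mul_Kfil {d : ℕ} (hd : 1 ≤ d) {h : Kset S} (hh : h ∈ BK S d) :
    ∃ b k : Kset S, b.1 ∈ Bcal S ∧ (∀ i j, (k.1 - 1) i j ∈ S.fracIdeal d) ∧ h = b * k ∧
      b.1 0 0 - h.1 0 0 ∈ S.fracIdeal d := by
  have he := (Kset_unit (BK_lower hd hh)).2
  have he0 := ne_zero_of_unit he
  have hse0 : S.sig (h.1 1 1) ≠ 0 := ne_zero_of_unit (by rw [S.nu_sig, he])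
  have hrow := (Gset_row h.2.1).2.1
  set c := h.1 1 0 * (h.1 1 1)⁻¹ with hc
  have hcm : c ∈ S.fracIdeal d := mul_mem_right hh (unit_mem (nu_inv_unit he))
  have hsc : S.sig c = -c := by
    rw [hc, map_mul, map_inv₀]
    field_simp
    linear_combination hrow
  have hc0 : c ∈ S.fracIdeal 0 := fracIdeal_anti (by omega) hcm
  let k : Kset S := ⟨!![1, 0; c, 1], mem_Kset_iff.2 ⟨mem_Gset_iff.2 (by simp [hsc]), by
    simp [Fin.forall_fin_two, USetting.one_mem, zero_mem, hc0]⟩⟩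
  have h10 : (h * k⁻¹).1 1 0 = 0 := by
    rw [Kset_mul_inv_apply]
    simp only [k, Matrix.of_apply, Matrix.cons_val', Matrix.cons_val_zero, Matrix.cons_val_one,
      Matrix.cons_val_fin_one, map_one, hsc]
    rw [hc]
    field_simp
    ring
  refine ⟨h * k⁻¹, k, ⟨(h * k⁻¹).2, h10⟩, ?_, by simp, ?_⟩
  · simp [Fin.forall_fin_two, k, zero_mem, hcm]
  · rw [Kset_mul_apply]
    simp only [Kset_coe_inv, unitaryInv, k, Matrix.of_apply, Matrix.cons_val', Matrix.cons_val_zero,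
      Matrix.cons_val_one, Matrix.cons_val_fin_one, map_one, mul_one, add_sub_cancel_left]
    exact mul_mem_left (Kset_integral _ _ _) (sig_mem hcm)

theorem mem_Vsp_iff {χ : E → ℂ} (hχ : IsChar χ) {r d : ℕ}
    (ht : TrivOn χ (onePE S ((r : ℤ) + 1))) (hd : r + 1 ≤ d) {f : Mat E → ℂ} :
    f ∈ Vsp S χ d ↔ (∀ x, x ∉ Kset S → f x = 0) ∧
      (fun k : Kset S => f k.1) ∈ IndV (BK S d) (fun g => χ (g.1 0 0)) := by
  have hd1 : 1 ≤ d := by omega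
  constructor
  · rintro ⟨h0, hB, hK⟩
    refine ⟨h0, fun h hh g => ?_⟩
    obtain ⟨b, k, hb, hk, rfl, hbh⟩ := exists_Bcal_mul_Kfil hd1 hh
    have hbu : S.nu (b.1 0 0) = 0 :=
      (Kset_unit (g := b) (by rw [hb.2]; exact zero_mem _)).1
    have e : b * k * g = b * (g * (g⁻¹ * k * g)) := by group
    have h1 : χ (b.1 0 0) = χ ((b * k).1 0 0) :=
      hχ.congr ht (ne_zero_of_unit hbu) (Kset_unit (BK_lower hd1 hh)).1
        (fracIdeal_anti (by omega) hbh)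
    beta_reduce
    rw [← h1, e, Kset_coe_mul, hB _ hb _ (Subtype.prop _), Kset_coe_mul g,
      hK _ g.2 _ ⟨Subtype.prop _, conj_sub_one_mem hk g⟩]
  · rintro ⟨h0, hI⟩
    refine ⟨h0, fun b hb k hk => ?_, fun k hk g hg => ?_⟩
    · exact hI ⟨b, hb.1⟩ (show b 1 0 ∈ S.fracIdeal d from hb.2.symm ▸ zero_mem (S.fracIdeal d)) ⟨k, hk⟩
    · let k' : Kset S := ⟨k, hk⟩
      let g' : Kset S := ⟨g, hg.1⟩
      have hc := conj_sub_one_mem (k := g') hg.2 k'⁻¹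
      rw [inv_inv] at hc
      have h1 : k' * g' * k'⁻¹ ∈ BK S d := by simpa [mem_BK] using hc 1 0
      have h2 := hI _ h1 k'
      rw [inv_mul_cancel_right] at h2
      have h3 : χ ((k' * g' * k'⁻¹).1 0 0) = 1 := by
        refine ht _ (fracIdeal_anti (n := d) (by omega) ?_)
        simpa using hc 0 0
      beta_reduce at h2
      rw [h3, one_mul] at h2
      exact h2

open Classical in
/-- Extension by zero of a function on `K`. -/
def extK (S : USetting E) (φ : Kset S → ℂ) (x : Mat E) : ℂ :=
  if h : x ∈ Kset S then φ ⟨x, h⟩ else 0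

theorem extK_coe (φ : Kset S → ℂ) (k : Kset S) : extK S φ k.1 = φ k := by
  simp [extK]

theorem extK_of_notMem (φ : Kset S → ℂ) {x : Mat E} (hx : x ∉ Kset S) : extK S φ x = 0 := by
  simp [extK, hx]

theorem eq_of_eqOn_Kset {f f' : Mat E → ℂ} (hf : ∀ x, x ∉ Kset S → f x = 0)
    (hf' : ∀ x, x ∉ Kset S → f' x = 0) (h : ∀ k : Kset S, f k.1 = f' k.1) : f = f' := by
  funext x
  by_cases hx : x ∈ Kset S
  · exact h ⟨x, hx⟩
  · rw [hf x hx, hf' x hx]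

theorem mul_notMem_Kset {x : Mat E} (hx : x ∉ Kset S) (g : Kset S) : x * g.1 ∉ Kset S := by
  intro h
  apply hx
  have h1 : g.1 * g⁻¹.1 = 1 := mul_eq_one_comm.1 (unitaryInv_mul g.2.1)
  have h2 := mul_mem_Kset h g⁻¹.2
  rwa [Matrix.mul_assoc, h1, Matrix.mul_one] at h2

theorem extK_mem {χ : E → ℂ} (hχ : IsChar χ) {r d : ℕ}
    (ht : TrivOn χ (onePE S ((r : ℤ) + 1))) (hd : r + 1 ≤ d) {φ : Kset S → ℂ}
    (hφ : φ ∈ IndV (BK S d) (fun g => χ (g.1 0 0))) : extK S φ ∈ Vsp S χ d := by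
  refine (mem_Vsp_iff hχ ht hd).2 ⟨fun x hx => extK_of_notMem φ hx, ?_⟩
  simpa only [extK_coe] using hφ

theorem rho_mem {χ : E → ℂ} (hχ : IsChar χ) {r d : ℕ}
    (ht : TrivOn χ (onePE S ((r : ℤ) + 1))) (hd : r + 1 ≤ d) {f : Mat E → ℂ} (hf : f ∈ Vsp S χ d)
    (g : Kset S) : rho g.1 f ∈ Vsp S χ d := by
  rw [mem_Vsp_iff hχ ht hd] at hf ⊢
  refine ⟨fun x hx => hf.1 _ (mul_notMem_Kset hx g), fun h hh k => ?_⟩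
  have := hf.2 h hh (k * g)
  rw [← mul_assoc] at this
  exact this

/-- Endomorphisms of `V_χ^{K_d}` correspond to bi-equivariant functions on `K`. -/
theorem finrank_Commutant {χ : E → ℂ} (hχ : IsChar χ) {r d : ℕ}
    (ht : TrivOn χ (onePE S ((r : ℤ) + 1))) (hd : r + 1 ≤ d) :
    Module.finrank ℂ (Commutant S (Vsp S χ d)) =
      Module.finrank ℂ (HeckeSp (BK S d) (fun g => χ (g.1 0 0))) := by
  have hd1 : 1 ≤ d := by omega
  have hmul := char_BK_mul (S := S) hχ ht hd
  have hne := char_BK_ne_zero (S := S) hχ hd1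
  have := Fintype.ofFinite (Kset S ⧸ BK S d)
  have hδ := indDelta_mem (H := BK S d) (χ := fun g => χ (g.1 0 0)) hmul
  set δ := indDelta (BK S d) (fun g => χ (g.1 0 0)) with hδdef
  let D : Vsp S χ d := ⟨extK S δ, extK_mem hχ ht hd hδ.1⟩
  have hV : ∀ f : Vsp S χ d, (∀ x, x ∉ Kset S → f.1 x = 0) ∧
      (fun k : Kset S => f.1 k.1) ∈ IndV (BK S d) (fun g => χ (g.1 0 0)) :=
    fun f => (mem_Vsp_iff hχ ht hd).1 f.2
  let Φ : Commutant S (Vsp S χ d) →ₗ[ℂ] HeckeSp (BK S d) (fun g => χ (g.1 0 0)) :=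
    { toFun := fun T => ⟨fun k => (T.1 D).1 k.1, (hV _).2, fun h hh g => by
        have h1 := T.2.2.2 h.1 h.2 D (rho_mem hχ ht hd D.2 h)
        have h2 : (⟨rho h.1 D.1, rho_mem hχ ht hd D.2 h⟩ : Vsp S χ d) = χ (h.1 0 0) • D := by
          refine Subtype.ext (eq_of_eqOn_Kset (hV ⟨rho h.1 D.1, rho_mem hχ ht hd D.2 h⟩).1
            (hV _).1 fun k => ?_)
          have h3 := hδ.2 h hh k
          rw [← extK_coe δ k, ← extK_coe δ (k * h)] at h3
          exact h3
        rw [h2, T.2.2.1] at h1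
        exact (congrFun h1 g.1).symm⟩
      map_add' := fun _ _ => rfl
      map_smul' := fun _ _ => rfl }
  have hΦ : Function.Bijective Φ := by
    constructor
    · rw [injective_iff_map_eq_zero]
      intro T hT
      have hTD : T.1 D = 0 := by
        refine Subtype.ext (eq_of_eqOn_Kset (hV _).1 (fun _ _ => rfl) fun k => ?_)
        exact congrFun (congrArg Subtype.val hT) k
      let L : Vsp S χ d →ₗ[ℂ] Vsp S χ d :=
        { toFun := T.1, map_add' := T.2.1, map_smul' := T.2.2.1 }
      refine Subtype.ext (funext fun f => ?_)
      have hf : f = ∑ x : Kset S ⧸ BK S d, f.1 x.out⁻¹.1 •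
          (⟨rho x.out.1 D.1, rho_mem hχ ht hd D.2 x.out⟩ : Vsp S χ d) := by
        refine Subtype.ext (eq_of_eqOn_Kset (hV f).1 (hV _).1 fun k => ?_)
        have h1 := congrFun (indConv_delta_left hmul hne (hV f).2) k
        rw [← h1]
        simp only [indConv, AddSubmonoidClass.coe_finsetSum, Finset.sum_apply, Submodule.coe_smul,
          Pi.smul_apply, smul_eq_mul]
        refine Finset.sum_congr rfl fun x _ => ?_
        rw [← hδdef, ← extK_coe δ (k * x.out)]
        rfl
      change L f = 0
      rw [hf, map_sum]
      refine Finset.sum_eq_zero fun x _ => ?_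
      rw [map_smul]
      have h2 : L ⟨rho x.out.1 D.1, rho_mem hχ ht hd D.2 x.out⟩ = 0 := by
        refine Subtype.ext ((T.2.2.2 x.out.1 x.out.2 D _).trans ?_)
        rw [hTD]
        simp
      rw [h2, smul_zero]
    · intro φ
      let T : Vsp S χ d → Vsp S χ d := fun f =>
        ⟨extK S (indConv (BK S d) φ.1 fun k => f.1 k.1), extK_mem hχ ht hd (indConv_mem φ.2 _)⟩
      have hT : ∀ f (k : Kset S), (T f).1 k.1 = indConv (BK S d) φ.1 (fun k => f.1 k.1) k :=
        fun f k => extK_coe _ k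
      refine ⟨⟨T, fun x y => ?_, fun c x => ?_, fun g hg f h => ?_⟩, ?_⟩
      · refine Subtype.ext (eq_of_eqOn_Kset (hV _).1 (hV _).1 fun k => ?_)
        refine (hT _ k).trans ?_
        change _ = (T x).1 k.1 + (T y).1 k.1
        rw [hT, hT]
        exact indConv_add _ _ _ k
      · refine Subtype.ext (eq_of_eqOn_Kset (hV _).1 (hV _).1 fun k => ?_)
        refine (hT _ k).trans ?_
        change _ = c * (T x).1 k.1
        rw [hT]
        exact indConv_smul _ _ _ k
      · refine eq_of_eqOn_Kset (hV _).1
          (fun x hx => (hV (T f)).1 _ (mul_notMem_Kset hx ⟨g, hg⟩)) fun k => ?_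
        have h1 := indConv_mul_right hmul hne φ.2 (hV f).2 ⟨g, hg⟩ k
        have h2 := hT f (k * ⟨g, hg⟩)
        rw [← h2] at h1
        exact (hT _ k).trans h1
      · refine Subtype.ext (funext fun k => ?_)
        refine (hT D k).trans ?_
        have h1 : (fun k : Kset S => D.1 k.1) = δ := funext fun k => extK_coe δ k
        rw [h1]
        exact congrFun (indConv_delta_right hmul hne φ.2) k
  exact (LinearEquiv.ofBijective Φ hΦ).finrank_eq

end Commutant

/-- for `χ` of minimal depth `r` and `d ≥ r+1`, the dimension of the space of
`ℂ`-linear endomorphisms of `V_χ^{K_d}` commuting with the `K`-action is `d+1` if `r = 0` and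
`χ` is trivial on `O_F^×`, and `d − r` otherwise. -/
theorem stmt7 (S : USetting E) (χ : E → ℂ) (hχ : IsChar χ) (r : ℕ)
    (hr : MinDepth S χ r) (d : ℕ) (hd : r + 1 ≤ d) :
    ((r = 0 ∧ TrivOn χ (OFunits S)) →
      Module.finrank ℂ ↥(Commutant S (Vsp S χ (d : ℤ))) = d + 1) ∧
    (¬ (r = 0 ∧ TrivOn χ (OFunits S)) →
      Module.finrank ℂ ↥(Commutant S (Vsp S χ (d : ℤ))) = d - r) := by
  obtain ⟨⟨ht, -⟩, -, hnt⟩ := hr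
  rw [finrank_Commutant hχ ht hd]
  refine ⟨fun ⟨hr0, htriv⟩ => ?_, fun hnot => ?_⟩
  · subst hr0
    rw [finrank_HeckeSp hχ ht hd (s := Finset.range (d + 1))]
    · simp
    · intro i hi
      rw [Finset.mem_range] at hi
      refine ⟨by omega, ?_⟩
      rcases Nat.eq_zero_or_pos i with h0 | h0
      · refine Or.inr ⟨h0, rfl, fun x hx => htriv _ ⟨?_, ?_⟩⟩
        · rw [map_mul, S.sig_invol, mul_comm]
        · exact USetting.nu_mul_unit hx (by rw [S.nu_sig, hx])
      · exact Or.inl (by omega)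
    · intro i hi hi'
      simp at hi'
      omega
  · rw [finrank_HeckeSp hχ ht hd (s := Finset.Icc (r + 1) d)]
    · simp
    · intro i hi
      rw [Finset.mem_Icc] at hi
      exact ⟨hi.2, Or.inl hi.1⟩
    · intro i hi hi' φ hφ
      have hir : i ≤ r := by
        by_contra h
        exact hi' (Finset.mem_Icc.2 ⟨by omega, hi⟩)
      unfold cosetRep
      split_ifs with h0
      · obtain ⟨y, ⟨hsy, hy⟩, hχy⟩ : ∃ y ∈ OFunits S, χ y ≠ 1 := by
          rcases Nat.eq_zero_or_pos r with hr0 | hr0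
          · by_contra! h
            exact hnot ⟨hr0, h⟩
          · obtain ⟨y, ⟨hsy, hy⟩, hχy⟩ : ∃ y ∈ onePF S r, χ y ≠ 1 := by
              by_contra! h
              exact hnt.resolve_left hr0.ne' h
            refine ⟨y, ⟨hsy, USetting.nu_eq_zero_iff_of_sub (y := 1) ?_ USetting.nu_one⟩, hχy⟩
            exact USetting.fracIdeal_anti (by omega) hy
        obtain ⟨a, ha, hay⟩ := USetting.exists_norm_sub_mem hsy hy r
        refine HeckeSp_weyl_eq_zero hχ ha ?_ hφ
        rwa [hχ.congr ht (USetting.ne_zero_of_unit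
          (USetting.nu_mul_unit ha (by rw [S.nu_sig, ha]))) hy hay]
      · obtain ⟨y, ⟨hsy, hy⟩, hχy⟩ : ∃ y ∈ onePF S r, χ y ≠ 1 := by
          by_contra! h
          exact hnt.resolve_left (by omega) h
        obtain ⟨z, hz⟩ : ∃ z, z = (y - 1) / 2 := ⟨_, rfl⟩
        have h2 := S.two_ne_zero'
        have hy2 : y = 1 + 2 * z := by rw [hz]; field_simp; ring
        have hzm : z ∈ S.fracIdeal r := hz ▸ USetting.half_mem hy
        have hsz : S.sig z = z := by rw [hz, map_div₀, map_sub, hsy, map_one, map_ofNat]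
        have hu : ∀ w ∈ S.fracIdeal r, S.nu (1 + w) = 0 := fun w hw =>
          USetting.nu_eq_zero_iff_of_sub (y := 1)
            (by rw [add_sub_cancel_left]; exact USetting.fracIdeal_anti (by omega) hw)
            USetting.nu_one
        have hz0 := USetting.ne_zero_of_unit (hu z hzm)
        refine HeckeSp_lowerUnip_eq_zero hχ (a := 1 + z) (by rw [map_add, map_one, hsz])
          (hu z hzm) ?_ ?_ hφ
        · rw [add_sub_cancel_left]
          exact USetting.fracIdeal_anti (by omega) hzm
        · rwa [hχ.congr ht (y := y) (mul_ne_zero hz0 hz0) ?_ ?_]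
          · have := hu (y - 1) hy
            rwa [add_sub_cancel] at this
          · have e : (1 + z) * (1 + z) - y = z * z := by rw [hy2]; ring
            rw [e]
            exact USetting.fracIdeal_anti (by omega) (USetting.mul_mem_add hzm hzm)
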